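/- arXiv:1412.8295 — 2 statements merged into one kernel-verified Lean document; each statement's English description precedes it below -/
import Mathlib

section
/- For every $q\in\mathbb{R}$, the projected measure $\nu=\gamma_\ast(\mu)$ on $[0,1]$ (whose support is $[0,1]$) satisfies $B_\nu(q)=B_\mu(q)=\max\{\theta_a(q),\theta_b(q)\}$, where $B$ is Olsen's multifractal packing dimension function. -/
open MeasureTheory Metric Set Filter Topology Classical
open scoped ENNReal NNReal

noncomputable section

namespace MF

/-! ### Olsen's multifractal measures and dimension functions on a metric space -/

variable {X : Type} [MetricSpace X]

/-- The sum `∑ m(B(xᵢ,rᵢ))^q (2rᵢ)^t` associated with a countable family of centered balls. -/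
def olsenSum [MeasurableSpace X] (m : Measure X) (q t : ℝ) {ι : Type}
    (c : ι → X) (r : ι → ℝ) : ℝ≥0∞ :=
  ∑' i, m (closedBall (c i) (r i)) ^ q * ENNReal.ofReal (2 * r i) ^ t

/-- `Olsen's 𝓗^{q,t}_{m,δ}`: infimum over countable centered `δ`-coverings of `E`. -/
def Hdel [MeasurableSpace X] (m : Measure X) (q t δ : ℝ) (E : Set X) : ℝ≥0∞ :=
  ⨅ (ι : Type) (_ : Countable ι) (c : ι → X) (r : ι → ℝ)
    (_ : ∀ i, c i ∈ E) (_ : ∀ i, 0 < r i ∧ r i ≤ δ)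
    (_ : E ⊆ ⋃ i, closedBall (c i) (r i)), olsenSum m q t c r

/-- Olsen's premeasure `𝓗̄^{q,t}_m` (limit, i.e. supremum, as `δ ↓ 0`). -/
def Hpre [MeasurableSpace X] (m : Measure X) (q t : ℝ) (E : Set X) : ℝ≥0∞ :=
  ⨆ (δ : ℝ) (_ : 0 < δ), Hdel m q t δ E

/-- Olsen's multifractal Hausdorff measure `𝓗^{q,t}_m`. -/
def Hmeas [MeasurableSpace X] (m : Measure X) (q t : ℝ) (E : Set X) : ℝ≥0∞ :=
  ⨆ (F : Set X) (_ : F ⊆ E), Hpre m q t F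

/-- `𝓟̄^{q,t}_{m,δ}`: supremum over countable centered `δ`-packings of `E`. -/
def Pdel [MeasurableSpace X] (m : Measure X) (q t δ : ℝ) (E : Set X) : ℝ≥0∞ :=
  ⨆ (ι : Type) (_ : Countable ι) (c : ι → X) (r : ι → ℝ)
    (_ : ∀ i, c i ∈ E) (_ : ∀ i, 0 < r i ∧ r i ≤ δ)
    (_ : ∀ i j, i ≠ j → Disjoint (closedBall (c i) (r i)) (closedBall (c j) (r j))),
    olsenSum m q t c r

/-- Olsen's packing premeasure `𝓟̄^{q,t}_m` (limit, i.e. infimum, as `δ ↓ 0`). -/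
def Ppre [MeasurableSpace X] (m : Measure X) (q t : ℝ) (E : Set X) : ℝ≥0∞ :=
  ⨅ (δ : ℝ) (_ : 0 < δ), Pdel m q t δ E

/-- Olsen's multifractal packing measure `𝓟^{q,t}_m`. -/
def Pmeas [MeasurableSpace X] (m : Measure X) (q t : ℝ) (E : Set X) : ℝ≥0∞ :=
  ⨅ (En : ℕ → Set X) (_ : E ⊆ ⋃ n, En n), ∑' n, Ppre m q t (En n)

/-- The (topological) support of a measure on a metric space. -/
def msupport [MeasurableSpace X] (m : Measure X) : Set X :=
  {x | ∀ r : ℝ, 0 < r → 0 < m (ball x r)}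

/-- Olsen's multifractal Hausdorff dimension function `b_m`. -/
def bFun [MeasurableSpace X] (m : Measure X) (q : ℝ) : ℝ :=
  sInf {t | Hmeas m q t (msupport m) = 0}

/-- Olsen's multifractal packing dimension function `B_m`. -/
def BFun [MeasurableSpace X] (m : Measure X) (q : ℝ) : ℝ :=
  sInf {t | Pmeas m q t (msupport m) = 0}

/-- Olsen's function `τ_m`. -/
def tauFun [MeasurableSpace X] (m : Measure X) (q : ℝ) : ℝ :=
  sInf {t | Ppre m q t (msupport m) = 0}

/-- `t`-dimensional packing pre-premeasure at scale `δ`. -/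
def pPdel (t δ : ℝ) (E : Set X) : ℝ≥0∞ :=
  ⨆ (ι : Type) (_ : Countable ι) (c : ι → X) (r : ι → ℝ)
    (_ : ∀ i, c i ∈ E) (_ : ∀ i, 0 < r i ∧ r i ≤ δ)
    (_ : ∀ i j, i ≠ j → Disjoint (closedBall (c i) (r i)) (closedBall (c j) (r j))),
    ∑' i, ENNReal.ofReal (2 * r i) ^ t

/-- `t`-dimensional packing premeasure. -/
def pPpre (t : ℝ) (E : Set X) : ℝ≥0∞ := ⨅ (δ : ℝ) (_ : 0 < δ), pPdel t δ E

/-- `t`-dimensional packing measure. -/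
def pPmeas (t : ℝ) (E : Set X) : ℝ≥0∞ :=
  ⨅ (En : ℕ → Set X) (_ : E ⊆ ⋃ n, En n), ∑' n, pPpre t (En n)

/-- Packing dimension of a set. -/
def packDim (E : Set X) : ℝ := sInf {t | pPmeas t E = 0}

/-- The level set `X_m(α)` of points of the support where the local Hölder exponent is `α`. -/
def Xlev [MeasurableSpace X] (m : Measure X) (α : ℝ) : Set X :=
  {x | x ∈ msupport m ∧
    Tendsto (fun r => Real.log (m (closedBall x r)).toReal / Real.log r)
      (𝓝[>] (0 : ℝ)) (𝓝 α)}

/-- Legendre transform `f^*(x) = inf_y (xy + f(y))`. -/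
def leg (f : ℝ → ℝ) (x : ℝ) : ℝ := ⨅ y : ℝ, (x * y + f y)

/-! ### The mixed symbolic space and inhomogeneous multinomial measures -/

/-- `j` is an index governed by the first alphabet:
`T (2k-1) ≤ j < T (2k)` for some `k ≥ 1`. -/
def isA (T : ℕ → ℕ) (j : ℕ) : Prop :=
  ∃ k, 1 ≤ k ∧ T (2 * k - 1) ≤ j ∧ j < T (2 * k)

/-- The size of the alphabet at (0-based) position `n`, i.e. at paper index `j = n+1`. -/
def Yc (c₁ c₂ : ℕ) (T : ℕ → ℕ) (n : ℕ) : ℕ := if isA T (n + 1) then c₁ else c₂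

/-- The mixed symbolic space `∂𝒜₁,₂* = ∏ⱼ Yⱼ`. -/
abbrev Omg (c₁ c₂ : ℕ) (T : ℕ → ℕ) : Type := ∀ n : ℕ, Fin (Yc c₁ c₂ T n)

/-- Finite words of length `n`. -/
abbrev Word (c₁ c₂ : ℕ) (T : ℕ → ℕ) (n : ℕ) : Type :=
  ∀ i : Fin n, Fin (Yc c₁ c₂ T i.val)

/-- `N_n`: the number of indices `1 ≤ j ≤ n` governed by the first alphabet. -/
def Ncount (T : ℕ → ℕ) (n : ℕ) : ℕ := ((Finset.Icc 1 n).filter (isA T)).card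

/-- Diameter `c₁^{-N_n} c₂^{-(n-N_n)}` of a cylinder of generation `n`. -/
def Dw (c₁ c₂ : ℕ) (T : ℕ → ℕ) (n : ℕ) : ℝ :=
  ((c₁ : ℝ) ^ Ncount T n * (c₂ : ℝ) ^ (n - Ncount T n))⁻¹

/-- The cylinder `[w]` defined by a finite word `w`. -/
def cyl (c₁ c₂ : ℕ) (T : ℕ → ℕ) (n : ℕ) (w : Word c₁ c₂ T n) : Set (Omg c₁ c₂ T) :=
  {x | ∀ i : Fin n, x i.val = w i}

/-- The mass `∏_{j≤n} p_j` given to the cylinder `[w]` by the inhomogeneous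
multinomial measure with weights `a` and `b`. -/
def cylWeight (c₁ c₂ : ℕ) (T : ℕ → ℕ) (a b : ℕ → ℝ) (n : ℕ) (w : Word c₁ c₂ T n) : ℝ :=
  ∏ i : Fin n, (if isA T (i.val + 1) then a (w i).val else b (w i).val)

/-- `θ(q) = log_c (p₁^q + ⋯ + p_c^q)`. -/
def theta (c : ℕ) (p : ℕ → ℝ) (q : ℝ) : ℝ :=
  Real.logb c (∑ i ∈ Finset.range c, p i ^ q)

/-- `τ_{μ,n}(q)`, defined by `∑_{z ∈ 𝒜₁,₂ⁿ} μ([z])^q = |w|^{-τ_{μ,n}(q)}`. -/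
def tauN (c₁ c₂ : ℕ) (T : ℕ → ℕ) (a b : ℕ → ℝ) (q : ℝ) (n : ℕ) : ℝ :=
  Real.log (∑ z : Word c₁ c₂ T n, cylWeight c₁ c₂ T a b n z ^ q) /
    Real.log ((c₁ : ℝ) ^ Ncount T n * (c₂ : ℝ) ^ (n - Ncount T n))

/-- The natural projection `γ : ∂𝒜₁,₂* → [0,1]`,
`γ(ε₁ε₂⋯) = ∑_{n≥1} εₙ c₁^{-N_n} c₂^{-(n-N_n)}`. -/
def gammaMap (c₁ c₂ : ℕ) (T : ℕ → ℕ) (x : Omg c₁ c₂ T) : ℝ :=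
  ∑' n : ℕ, ((x n).val : ℝ) * Dw c₁ c₂ T (n + 1)

/-- The normalized weights `pᵢ^q / (p₁^q + ⋯ + p_c^q)`. -/
def taW (c : ℕ) (p : ℕ → ℝ) (q : ℝ) (i : ℕ) : ℝ :=
  p i ^ q / ∑ j ∈ Finset.range c, p j ^ q

/-- `s₁ = min{max aᵢ, max bⱼ}`. -/
def sOne (c₁ c₂ : ℕ) (a b : ℕ → ℝ) : ℝ :=
  min (sSup {x | ∃ i < c₁, a i = x}) (sSup {x | ∃ j < c₂, b j = x})

/-- `s₂ = max{min aᵢ, min bⱼ}`. -/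
def sTwo (c₁ c₂ : ℕ) (a b : ℕ → ℝ) : ℝ :=
  max (sInf {x | ∃ i < c₁, a i = x}) (sInf {x | ∃ j < c₂, b j = x})

/-- Entropy `h(p) = -∑_{i<2} pᵢ log₂ pᵢ`. -/
def hEnt (p : ℕ → ℝ) : ℝ := -(∑ i ∈ Finset.range 2, p i * Real.logb 2 (p i))

/-! ### Dyadic intervals -/

/-- The family `𝓕_n` of dyadic intervals of generation `n` in `[0,1]`. -/
def Fnfam (n : ℕ) : Set (Set ℝ) :=
  {I | ∃ j : ℕ, j < 2 ^ n ∧ I = Set.Icc ((j : ℝ) / 2 ^ n) (((j : ℝ) + 1) / 2 ^ n)}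

/-- Index of the dyadic interval of generation `n` containing `x`
(the left one when `x` is dyadic). -/
def dyadIdx (n : ℕ) (x : ℝ) : ℤ := ⌈x * 2 ^ n⌉ - 1

/-- `I_n(x)`: the dyadic interval of generation `n` containing `x`
(the left one when `x` is dyadic). -/
def Idyad (n : ℕ) (x : ℝ) : Set ℝ :=
  Set.Icc ((dyadIdx n x : ℝ) / 2 ^ n) (((dyadIdx n x : ℝ) + 1) / 2 ^ n)

/-- `I_n(x)⁺`: the right neighbour of `I_n(x)` in `𝓕_n`. -/
def IdyadP (n : ℕ) (x : ℝ) : Set ℝ :=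
  Set.Icc (((dyadIdx n x : ℝ) + 1) / 2 ^ n) (((dyadIdx n x : ℝ) + 2) / 2 ^ n)

/-- `I_n(x)⁻`: the left neighbour of `I_n(x)` in `𝓕_n`. -/
def IdyadM (n : ℕ) (x : ℝ) : Set ℝ :=
  Set.Icc (((dyadIdx n x : ℝ) - 1) / 2 ^ n) ((dyadIdx n x : ℝ) / 2 ^ n)

/-! ### Mixed radix expansions -/

/-- The diameter `∏_{i<n} e_i⁻¹` of a cylinder of generation `n` for the digit sizes `e`. -/
def radixDiam (e : ℕ → ℕ) (n : ℕ) : ℝ := ∏ i ∈ Finset.range n, (e i : ℝ)⁻¹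

/-- The integer with mixed radix digits `x 0, …, x (n-1)`, most significant first. -/
def radixIdx {e : ℕ → ℕ} (x : ∀ n, Fin (e n)) : ℕ → ℕ
  | 0 => 0
  | n + 1 => radixIdx x n * e n + x n

/-- The real number with mixed radix digits `x`. -/
def radixVal {e : ℕ → ℕ} (x : ∀ n, Fin (e n)) : ℝ :=
  ∑' n, ((x n).val : ℝ) * radixDiam e (n + 1)

/-- The word formed by the first `n` digits of `x`. -/
def radixRes {e : ℕ → ℕ} (n : ℕ) (x : ∀ n, Fin (e n)) : ∀ i : Fin n, Fin (e i.val) :=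
  fun i => x i.val

/-- The sequence starting with the word `w` and continuing with the digits of `z`. -/
def radixExt {e : ℕ → ℕ} {n : ℕ} (w : ∀ i : Fin n, Fin (e i.val)) (z : ∀ n, Fin (e n)) :
    ∀ n, Fin (e n) :=
  fun i => if h : i < n then w ⟨i, h⟩ else z i

section Radix

variable {e : ℕ → ℕ}

lemma radixRes_radixExt {n : ℕ} (w : ∀ i : Fin n, Fin (e i.val)) (z : ∀ n, Fin (e n)) :
    radixRes n (radixExt w z) = w := by
  funext i
  simp [radixRes, radixExt]

lemma radixRes_eq_iff {n : ℕ} {x y : ∀ n, Fin (e n)} :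
    radixRes n x = radixRes n y ↔ ∀ i < n, x i = y i :=
  ⟨fun h i hi => congrFun h ⟨i, hi⟩, fun h => funext fun i => h i i.2⟩

lemma radixIdx_congr {x y : ∀ n, Fin (e n)} {n : ℕ} (h : ∀ i < n, x i = y i) :
    radixIdx x n = radixIdx y n := by
  induction n with
  | zero => rfl
  | succ n ih =>
    simp only [radixIdx]
    rw [ih fun i hi => h i (by omega), h n (by omega)]

lemma eq_of_radixIdx_eq {x y : ∀ n, Fin (e n)} {n : ℕ} (h : radixIdx x n = radixIdx y n) :
    ∀ i < n, x i = y i := by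
  induction n with
  | zero => intro i hi; omega
  | succ n ih =>
    simp only [radixIdx] at h
    have hx := (x n).2
    have hy := (y n).2
    have h1 : radixIdx x n = radixIdx y n := by
      have := congrArg (· / e n) h
      simpa [Nat.mul_add_div, Nat.add_div_of_dvd_right, Nat.div_eq_of_lt hx,
        Nat.div_eq_of_lt hy, Nat.mul_comm _ (e n), Nat.mul_add_div (by omega : 0 < e n)] using this
    have h2 : (x n).val = (y n).val := by rw [h1] at h; omega
    intro i hi
    rcases Nat.lt_succ_iff_lt_or_eq.1 hi with hi | rfl
    · exact ih h1 i hi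
    · exact Fin.ext h2

lemma radixDiam_succ (n : ℕ) : radixDiam e (n + 1) = radixDiam e n * (e n : ℝ)⁻¹ := by
  simp only [radixDiam, Finset.prod_range_succ]

variable (he : ∀ i, 2 ≤ e i)
include he

lemma radixDiam_pos (n : ℕ) : 0 < radixDiam e n :=
  Finset.prod_pos fun i _ => inv_pos.2 (by have := he i; positivity)

lemma radixDiam_succ_mul (n : ℕ) : radixDiam e (n + 1) * e n = radixDiam e n := by
  have : (e n : ℝ) ≠ 0 := by have := he n; positivity
  rw [radixDiam_succ]; field_simp

lemma two_mul_radixDiam_succ_le (n : ℕ) : 2 * radixDiam e (n + 1) ≤ radixDiam e n := by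
  rw [← radixDiam_succ_mul he n, mul_comm]
  exact mul_le_mul_of_nonneg_left (by exact_mod_cast he n) (radixDiam_pos he _).le

lemma radixDiam_antitone : Antitone (radixDiam e) :=
  antitone_nat_of_succ_le fun n => by
    linarith [two_mul_radixDiam_succ_le he n, radixDiam_pos he (n + 1)]

lemma radixDiam_le_half_pow (n : ℕ) : radixDiam e n ≤ (1 / 2) ^ n := by
  induction n with
  | zero => simp [radixDiam]
  | succ n ih => rw [pow_succ]; linarith [two_mul_radixDiam_succ_le he n]

lemma radixDiam_le_mul_succ {c : ℕ} (hc : ∀ i, e i ≤ c) (n : ℕ) :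
    radixDiam e n ≤ c * radixDiam e (n + 1) := by
  rw [← radixDiam_succ_mul he n, mul_comm]
  exact mul_le_mul_of_nonneg_right (by exact_mod_cast hc n) (radixDiam_pos he _).le

lemma radix_sum_range (x : ∀ n, Fin (e n)) (n : ℕ) :
    ∑ i ∈ Finset.range n, ((x i).val : ℝ) * radixDiam e (i + 1) = radixIdx x n * radixDiam e n := by
  induction n with
  | zero => simp [radixIdx]
  | succ n ih =>
    rw [Finset.sum_range_succ, ih, ← radixDiam_succ_mul he n]
    simp only [radixIdx]
    push_cast
    ring

lemma radixIdx_mul_monotone (x : ∀ n, Fin (e n)) :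
    Monotone fun n => radixIdx x n * radixDiam e n :=
  monotone_nat_of_le_succ fun n => by
    rw [← radix_sum_range he, ← radix_sum_range he, Finset.sum_range_succ]
    have := radixDiam_pos he (n + 1)
    have : 0 ≤ ((x n).val : ℝ) * radixDiam e (n + 1) := by positivity
    linarith

lemma radixIdx_add_one_mul_antitone (x : ∀ n, Fin (e n)) :
    Antitone fun n => ((radixIdx x n : ℝ) + 1) * radixDiam e n :=
  antitone_nat_of_succ_le fun n => by
    have h1 : ((x n).val : ℝ) + 1 ≤ e n := by exact_mod_cast (x n).2
    rw [← radixDiam_succ_mul he n]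
    have := radixDiam_pos he (n + 1)
    simp only [radixIdx]
    push_cast
    nlinarith

lemma radix_summable (x : ∀ n, Fin (e n)) :
    Summable fun n => ((x n).val : ℝ) * radixDiam e (n + 1) := by
  refine summable_of_sum_range_le (c := 1)
    (fun n => mul_nonneg (Nat.cast_nonneg _) (radixDiam_pos he _).le) fun n => ?_
  have h := radixIdx_add_one_mul_antitone he x (Nat.zero_le n)
  rw [radix_sum_range he]
  simp [radixIdx, radixDiam] at h ⊢
  have := radixDiam_pos he n
  simp only [radixDiam, Finset.prod_inv_distrib] at this
  nlinarith

lemma radix_tendsto (x : ∀ n, Fin (e n)) :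
    Tendsto (fun n => radixIdx x n * radixDiam e n) atTop (𝓝 (radixVal x)) := by
  have h := (radix_summable he x).hasSum.tendsto_sum_nat
  simp only [radix_sum_range he] at h
  exact h

lemma radixIdx_mul_le_radixVal (x : ∀ n, Fin (e n)) (n : ℕ) :
    radixIdx x n * radixDiam e n ≤ radixVal x :=
  (radixIdx_mul_monotone he x).ge_of_tendsto (radix_tendsto he x) n

lemma radixVal_le (x : ∀ n, Fin (e n)) (n : ℕ) :
    radixVal x ≤ ((radixIdx x n : ℝ) + 1) * radixDiam e n := by
  refine le_of_tendsto (radix_tendsto he x) ?_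
  filter_upwards [eventually_ge_atTop n] with m hm
  have h := radixIdx_add_one_mul_antitone he x hm
  have := radixDiam_pos he m
  simp only at h
  linarith

lemma abs_radixVal_sub_le {x y : ∀ n, Fin (e n)} {n : ℕ} (h : ∀ i < n, x i = y i) :
    |radixVal x - radixVal y| ≤ radixDiam e n := by
  have h1 := radixIdx_mul_le_radixVal he x n
  have h2 := radixVal_le he x n
  have h3 := radixIdx_mul_le_radixVal he y n
  have h4 := radixVal_le he y n
  rw [radixIdx_congr h] at h1 h2
  rw [abs_le]
  constructor <;> linarith

lemma radixIdx_le_add {x y : ∀ n, Fin (e n)} {n K : ℕ}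
    (h : |radixVal x - radixVal y| ≤ K * radixDiam e n) :
    radixIdx x n ≤ radixIdx y n + (K + 1) := by
  have h1 := radixIdx_mul_le_radixVal he x n
  have h2 := radixVal_le he y n
  have h3 : (radixIdx x n : ℝ) * radixDiam e n
      ≤ ((radixIdx y n + (K + 1) : ℕ) : ℝ) * radixDiam e n := by
    push_cast
    linarith [(abs_le.1 h).2]
  exact_mod_cast le_of_mul_le_mul_right h3 (radixDiam_pos he n)

lemma measurable_radixVal : Measurable (radixVal : (∀ n, Fin (e n)) → ℝ) := by
  refine measurable_of_tendsto_metrizable (f := fun (n : ℕ) (x : ∀ n, Fin (e n)) =>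
    ∑ i ∈ Finset.range n, ((x i).val : ℝ) * radixDiam e (i + 1)) (fun n => ?_) ?_
  · refine Finset.measurable_sum _ fun i _ => ?_
    exact ((measurable_of_finite (fun k : Fin (e i) => (k.val : ℝ))).comp
      (measurable_pi_apply i)).mul_const _
  · exact tendsto_pi_nhds.2 fun x => (radix_summable he x).hasSum.tendsto_sum_nat

lemma radixVal_bounds_of_digits {x : ∀ n, Fin (e n)} {n : ℕ} (h0 : (x n).val = 0)
    (h1 : (x (n + 1)).val = 1) (h2 : (x (n + 2)).val = 0) :
    radixIdx x n * radixDiam e n + radixDiam e (n + 2) ≤ radixVal x ∧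
      radixVal x ≤ radixIdx x n * radixDiam e n + radixDiam e (n + 2) + radixDiam e (n + 3) := by
  have key : (radixIdx x (n + 3) : ℝ) * radixDiam e (n + 3)
      = radixIdx x n * radixDiam e n + radixDiam e (n + 2) := by
    rw [← radix_sum_range he, Finset.sum_range_succ, Finset.sum_range_succ, Finset.sum_range_succ,
      radix_sum_range he, h0, h1, h2]
    push_cast
    ring
  have := radixIdx_mul_le_radixVal he x (n + 3)
  have := radixVal_le he x (n + 3)
  constructor <;> linarith

lemma eq_of_abs_radixVal_sub_le {x y : ∀ n, Fin (e n)} {n : ℕ} (h0 : (x n).val = 0)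
    (h1 : (x (n + 1)).val = 1) (h2 : (x (n + 2)).val = 0)
    (h : |radixVal y - radixVal x| ≤ radixDiam e (n + 3)) : ∀ i < n, y i = x i := by
  obtain ⟨hx1, hx2⟩ := radixVal_bounds_of_digits he h0 h1 h2
  obtain ⟨ha, hb⟩ := abs_le.1 h
  have hy1 := radixIdx_mul_le_radixVal he y n
  have hy2 := radixVal_le he y n
  have d1 := two_mul_radixDiam_succ_le he n
  have d2 := two_mul_radixDiam_succ_le he (n + 1)
  have d3 := two_mul_radixDiam_succ_le he (n + 2)
  have p3 := radixDiam_pos he (n + 3)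
  have p0 := (radixDiam_pos he n).le
  apply eq_of_radixIdx_eq
  rcases lt_trichotomy (radixIdx y n) (radixIdx x n) with hlt | heq | hgt
  · have h' : (radixIdx y n : ℝ) + 1 ≤ radixIdx x n := by exact_mod_cast hlt
    have := mul_le_mul_of_nonneg_right h' p0
    linarith
  · exact heq
  · have h' : (radixIdx x n : ℝ) + 1 ≤ radixIdx y n := by exact_mod_cast hgt
    have := mul_le_mul_of_nonneg_right h' p0
    linarith

lemma eq_of_abs_radixVal_sub_le_two_mul {x y : ∀ n, Fin (e n)} {n : ℕ}
    (hx0 : (x n).val = 0) (hx1 : (x (n + 1)).val = 1) (hx2 : (x (n + 2)).val = 0)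
    (hy0 : (y n).val = 0) (hy1 : (y (n + 1)).val = 1) (hy2 : (y (n + 2)).val = 0)
    (h : |radixVal y - radixVal x| ≤ 2 * radixDiam e (n + 3)) : ∀ i < n, y i = x i := by
  obtain ⟨hx1, hx2⟩ := radixVal_bounds_of_digits he hx0 hx1 hx2
  obtain ⟨hy1, hy2⟩ := radixVal_bounds_of_digits he hy0 hy1 hy2
  obtain ⟨ha, hb⟩ := abs_le.1 h
  have d1 := two_mul_radixDiam_succ_le he n
  have d2 := two_mul_radixDiam_succ_le he (n + 1)
  have d3 := two_mul_radixDiam_succ_le he (n + 2)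
  have p3 := radixDiam_pos he (n + 3)
  have p0 := (radixDiam_pos he n).le
  apply eq_of_radixIdx_eq
  rcases lt_trichotomy (radixIdx y n) (radixIdx x n) with hlt | heq | hgt
  · have h' : (radixIdx y n : ℝ) + 1 ≤ radixIdx x n := by exact_mod_cast hlt
    have := mul_le_mul_of_nonneg_right h' p0
    linarith
  · exact heq
  · have h' : (radixIdx x n : ℝ) + 1 ≤ radixIdx y n := by exact_mod_cast hgt
    have := mul_le_mul_of_nonneg_right h' p0
    linarith

end Radix

/-! ### Comparison lemmas for Olsen's packing measures -/

lemma rpow_le_mul_rpow {x y K : ℝ} (t : ℝ) (hx : 0 < x) (hy : 0 < y) (hK : 1 ≤ K)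
    (hxy : x ≤ K * y) (hyx : y ≤ K * x) : y ^ t ≤ K ^ |t| * x ^ t := by
  have hK0 : 0 < K := by linarith
  rcases le_total 0 t with ht | ht
  · rw [abs_of_nonneg ht, ← Real.mul_rpow hK0.le hx.le]
    exact Real.rpow_le_rpow hy.le hyx ht
  · have h := Real.rpow_le_rpow_of_nonpos hx hxy ht
    rw [Real.mul_rpow hK0.le hy.le] at h
    rw [abs_of_nonpos ht, Real.rpow_neg hK0.le]
    rw [inv_mul_eq_div, le_div_iff₀ (by positivity), mul_comm]
    exact h

lemma Pdel_le_rpow_mul [MeasurableSpace X] (m : Measure X) (q : ℝ) {s t δ : ℝ} (hst : s ≤ t)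
    (E : Set X) : Pdel m q t δ E ≤ ENNReal.ofReal (2 * δ) ^ (t - s) * Pdel m q s δ E := by
  refine iSup_le fun ι => iSup_le fun hι => iSup_le fun c => iSup_le fun r => iSup_le fun hc =>
    iSup_le fun hr => iSup_le fun hd => ?_
  have h1 : olsenSum m q s c r ≤ Pdel m q s δ E :=
    le_iSup_of_le ι <| le_iSup_of_le hι <| le_iSup_of_le c <| le_iSup_of_le r <|
      le_iSup_of_le hc <| le_iSup_of_le hr <| le_iSup_of_le hd le_rfl
  refine le_trans ?_ (mul_le_mul_right h1 _)
  rw [olsenSum, olsenSum, ← ENNReal.tsum_mul_left]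
  refine ENNReal.tsum_le_tsum fun i => ?_
  have hi := (hr i).1
  have h2 : ENNReal.ofReal (2 * r i) ^ t
      = ENNReal.ofReal (2 * r i) ^ (t - s) * ENNReal.ofReal (2 * r i) ^ s := by
    rw [← ENNReal.rpow_add _ _ (by simpa using hi) ENNReal.ofReal_ne_top, sub_add_cancel]
  rw [h2, ← mul_assoc, ← mul_assoc, mul_comm (_ ^ q)]
  gcongr
  exact (hr i).2

lemma Pmeas_eq_zero_of_Pdel_le [MeasurableSpace X] {m : Measure X} {q s t : ℝ} (hst : s < t)
    {E : Set X} {C : ℝ≥0∞} (hC : C ≠ ⊤) (h : ∀ δ, 0 < δ → δ ≤ 1 → Pdel m q s δ E ≤ C) :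
    Pmeas m q t E = 0 := by
  have hpre : Ppre m q t E = 0 := by
    have hlim : Tendsto (fun δ : ℝ => ENNReal.ofReal (2 * δ) ^ (t - s) * C) (𝓝[>] 0) (𝓝 0) := by
      have h1 : Tendsto (fun δ : ℝ => ENNReal.ofReal (2 * δ) ^ (t - s)) (𝓝 0) (𝓝 0) := by
        have : Continuous fun δ : ℝ => ENNReal.ofReal (2 * δ) ^ (t - s) :=
          (ENNReal.continuous_rpow_const).comp
            (ENNReal.continuous_ofReal.comp (continuous_const.mul continuous_id))
        simpa [ENNReal.zero_rpow_of_pos (sub_pos.2 hst)] using this.tendsto 0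
      simpa using (ENNReal.Tendsto.mul_const h1 (Or.inr hC)).mono_left nhdsWithin_le_nhds
    refine le_antisymm (ge_of_tendsto hlim ?_) bot_le
    filter_upwards [Ioc_mem_nhdsGT (zero_lt_one' ℝ)] with δ hδ
    exact (iInf₂_le δ hδ.1).trans ((Pdel_le_rpow_mul m q hst.le E).trans
      (mul_le_mul_right (h δ hδ.1 hδ.2) _))
  refine le_antisymm ((iInf₂_le (fun _ => E) (subset_iUnion (fun _ : ℕ => E) 0)).trans ?_) bot_le
  simp [hpre]

lemma BFun_eq_of_forall [MeasurableSpace X] {m : Measure X} {q M : ℝ}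
    (hzero : ∀ t, M < t → Pmeas m q t (msupport m) = 0)
    (hne : ∀ t, t < M → Pmeas m q t (msupport m) ≠ 0) : BFun m q = M := by
  refine IsGLB.csInf_eq ⟨fun t ht => ?_, fun b hb => ?_⟩ ⟨M + 1, hzero _ (by linarith)⟩
  · by_contra hlt
    exact hne t (not_le.1 hlt) ht
  · exact le_of_forall_gt_imp_ge_of_dense fun t ht => hb (hzero t ht)

/-- In a countable cover of a product of finite sets, one of the sets is dense in a cylinder. -/
lemma exists_dense_in_cylinder {e : ℕ → ℕ} (he : ∀ i, 2 ≤ e i)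
    (E : ℕ → Set (∀ n, Fin (e n))) (hE : ∀ x, ∃ k, x ∈ E k) :
    ∃ k l, ∃ x : ∀ n, Fin (e n), ∀ y : ∀ n, Fin (e n), (∀ i < l, y i = x i) →
      ∀ n, ∃ z ∈ E k, ∀ i < n, z i = y i := by
  have : Nonempty (∀ n, Fin (e n)) := ⟨fun n => ⟨0, by have := he n; omega⟩⟩
  obtain ⟨k, x, hx⟩ := nonempty_interior_of_iUnion_of_closed
    (f := fun k => closure (E k)) (fun _ => isClosed_closure)
    (eq_univ_of_forall fun x => mem_iUnion.2 ((hE x).imp fun k hk => subset_closure hk))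
  obtain ⟨_, ⟨x', l, rfl⟩, -, hsub⟩ :=
    (PiNat.isTopologicalBasis_cylinders fun n => Fin (e n)).exists_subset_of_mem_open hx
      isOpen_interior
  refine ⟨k, l, x', fun y hy n => ?_⟩
  have hy' : y ∈ closure (E k) := interior_subset (hsub hy)
  obtain ⟨z, hz, hzE⟩ := mem_closure_iff.1 hy' (PiNat.cylinder y n)
    (PiNat.isOpen_cylinder _ _ _) (PiNat.self_mem_cylinder _ _)
  exact ⟨z, hzE, hz⟩

/-! ### Product measures on mixed radix digit sequences -/

/-- The product `∏_{i<n} p_i(w_i)` of the weights of the digits of the word `w`. -/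
def radixWt {e : ℕ → ℕ} (p : ∀ i, Fin (e i) → ℝ) (n : ℕ) (w : ∀ i : Fin n, Fin (e i.val)) : ℝ :=
  ∏ i : Fin n, p i.val (w i)

/-- The words of length `n` whose index differs by at most `L` from the index of `w`
(the index is computed by completing words with the digits of `z`). -/
def radixNbr {e : ℕ → ℕ} (z : ∀ n, Fin (e n)) (L n : ℕ) (w : ∀ i : Fin n, Fin (e i.val)) :
    Finset (∀ i : Fin n, Fin (e i.val)) :=
  Finset.univ.filter fun v => radixIdx (radixExt v z) n ≤ radixIdx (radixExt w z) n + L ∧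
    radixIdx (radixExt w z) n ≤ radixIdx (radixExt v z) n + L

lemma ENNReal_sum_rpow_le {ι : Type*} {S : Finset ι} (hS : S.Nonempty) (f : ι → ℝ≥0∞) {K : ℕ}
    (hK : S.card ≤ K) {q : ℝ} (hq : 0 ≤ q) :
    (∑ i ∈ S, f i) ^ q ≤ (K : ℝ≥0∞) ^ q * ∑ i ∈ S, f i ^ q := by
  obtain ⟨j, hj, hmax⟩ := Finset.exists_max_image S f hS
  have h1 : ∑ i ∈ S, f i ≤ (K : ℝ≥0∞) * f j := by
    refine (Finset.sum_le_card_nsmul S f _ hmax).trans ?_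
    rw [nsmul_eq_mul]
    gcongr
  refine (ENNReal.rpow_le_rpow h1 hq).trans ?_
  rw [ENNReal.mul_rpow_of_nonneg _ _ hq]
  gcongr
  exact Finset.single_le_sum (f := fun i => f i ^ q) (fun _ _ => zero_le) hj

lemma ENNReal_rpow_le_sum_rpow {ι : Type*} {S : Finset ι} {f : ι → ℝ≥0∞} {K : ℕ}
    (hK : S.card ≤ K) {j : ι} (hj : j ∈ S) {x : ℝ≥0∞} (hjx : f j ≤ x) (hx : x ≤ ∑ i ∈ S, f i)
    (q : ℝ) : x ^ q ≤ (K : ℝ≥0∞) ^ |q| * ∑ i ∈ S, f i ^ q := by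
  rcases le_total 0 q with hq | hq
  · rw [abs_of_nonneg hq]
    exact (ENNReal.rpow_le_rpow hx hq).trans (ENNReal_sum_rpow_le ⟨j, hj⟩ f hK hq)
  · have hK1 : (1 : ℝ≥0∞) ≤ K := by
      exact_mod_cast (Finset.card_pos.2 ⟨j, hj⟩).trans_le hK
    calc x ^ q ≤ f j ^ q := by
          rw [← neg_neg q, ENNReal.rpow_neg x, ENNReal.rpow_neg (f j)]
          exact ENNReal.inv_le_inv.2 (ENNReal.rpow_le_rpow hjx (neg_nonneg.2 hq))
      _ ≤ ∑ i ∈ S, f i ^ q :=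
          Finset.single_le_sum (f := fun i => f i ^ q) (fun _ _ => zero_le) hj
      _ ≤ _ := le_mul_of_one_le_left zero_le
          (by simpa using ENNReal.rpow_le_rpow hK1 (abs_nonneg q))

section RadixMeasure

variable {e : ℕ → ℕ}

lemma radixWt_radixRes (p : ∀ i, Fin (e i) → ℝ) (n : ℕ) (x : ∀ n, Fin (e n)) :
    radixWt p n (radixRes n x) = ∏ i ∈ Finset.range n, p i (x i) :=
  Fin.prod_univ_eq_prod_range (fun i => p i (x i)) n

lemma radixWt_pos {p : ∀ i, Fin (e i) → ℝ} (hp : ∀ i k, 0 < p i k) (n : ℕ)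
    (w : ∀ i : Fin n, Fin (e i.val)) : 0 < radixWt p n w :=
  Finset.prod_pos fun _ _ => hp _ _

lemma sum_radixWt_rpow {p : ∀ i, Fin (e i) → ℝ} (hp : ∀ i k, 0 < p i k) (q : ℝ)
    (t : ∀ i, Finset (Fin (e i))) (n : ℕ) :
    ∑ w ∈ Fintype.piFinset (fun i : Fin n => t i.val), radixWt p n w ^ q
      = ∏ i ∈ Finset.range n, ∑ k ∈ t i, p i k ^ q := by
  rw [← Fin.prod_univ_eq_prod_range (fun i => ∑ k ∈ t i, p i k ^ q) n, Finset.prod_univ_sum]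
  exact Finset.sum_congr rfl fun w _ =>
    (Real.finsetProd_rpow _ _ (fun i _ => (hp _ _).le) q).symm

lemma mem_radixNbr_comm {z : ∀ n, Fin (e n)} {L n : ℕ} {v w : ∀ i : Fin n, Fin (e i.val)} :
    v ∈ radixNbr z L n w ↔ w ∈ radixNbr z L n v := by
  simp only [radixNbr, Finset.mem_filter, Finset.mem_univ, true_and]
  exact and_comm

lemma self_mem_radixNbr (z : ∀ n, Fin (e n)) (L n : ℕ) (w : ∀ i : Fin n, Fin (e i.val)) :
    w ∈ radixNbr z L n w := by
  simp [radixNbr]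

lemma radixIdx_radixExt_radixRes (x z : ∀ n, Fin (e n)) (n : ℕ) :
    radixIdx (radixExt (radixRes n x) z) n = radixIdx x n :=
  radixIdx_congr (radixRes_eq_iff.1 (radixRes_radixExt _ _))

lemma card_radixNbr_le (z : ∀ n, Fin (e n)) (L n : ℕ) (w : ∀ i : Fin n, Fin (e i.val)) :
    (radixNbr z L n w).card ≤ 2 * L + 1 := by
  have h : (radixNbr z L n w).card ≤ (Finset.Icc (radixIdx (radixExt w z) n - L)
      (radixIdx (radixExt w z) n + L)).card := by
    refine Finset.card_le_card_of_injOn (fun v => radixIdx (radixExt v z) n) (fun v hv => ?_)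
      fun u _ v _ huv => ?_
    · simp only [radixNbr, Finset.coe_filter, Finset.mem_univ, true_and, mem_ofPred_eq] at hv
      simp only [Finset.coe_Icc, Set.mem_Icc]
      omega
    · rw [← radixRes_radixExt u z, ← radixRes_radixExt v z]
      exact radixRes_eq_iff.2 (eq_of_radixIdx_eq huv)
  rw [Nat.card_Icc] at h
  omega

lemma tsum_radixNbr_ne_top (he : ∀ i, 2 ≤ e i) {p : ∀ i, Fin (e i) → ℝ}
    (hp : ∀ i k, 0 < p i k) {q M t : ℝ} (hM : ∀ i, ∑ k, p i k ^ q ≤ (e i : ℝ) ^ M)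
    (ht : M < t) (z : ∀ n, Fin (e n)) (L : ℕ) :
    ∑' s : (n : ℕ) × (∀ i : Fin n, Fin (e i.val)), ∑ v ∈ radixNbr z L s.1 s.2,
      ENNReal.ofReal (radixWt p s.1 v ^ q * radixDiam e s.1 ^ t) ≠ ⊤ := by
  set ρ : ℝ := (1 / 2 : ℝ) ^ (t - M) with hρ
  have hρ1 : ρ < 1 := Real.rpow_lt_one (by norm_num) (by norm_num) (by linarith)
  have hlevel : ∀ n, ∑ v : (∀ i : Fin n, Fin (e i.val)),
      ENNReal.ofReal (radixWt p n v ^ q * radixDiam e n ^ t) ≤ ENNReal.ofReal ρ ^ n := by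
    intro n
    have hD := radixDiam_pos he n
    rw [← ENNReal.ofReal_sum_of_nonneg fun v _ => by have := radixWt_pos hp n v; positivity,
      ← Finset.sum_mul, ← ENNReal.ofReal_pow (by positivity)]
    apply ENNReal.ofReal_le_ofReal
    have h1 := sum_radixWt_rpow hp q (fun _ => Finset.univ) n
    rw [Fintype.piFinset_univ] at h1
    have h2 : ∏ i ∈ Finset.range n, ∑ k, p i k ^ q ≤ radixDiam e n ^ (-M) := by
      rw [radixDiam, ← Real.finsetProd_rpow _ _ fun i _ => by positivity]
      refine Finset.prod_le_prod (fun i _ => Finset.sum_nonneg fun k _ =>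
        (Real.rpow_pos_of_pos (hp i k) q).le) fun i _ => ?_
      rw [Real.inv_rpow (by positivity), ← Real.rpow_neg (by positivity), neg_neg]
      exact hM i
    calc _ ≤ radixDiam e n ^ (-M) * radixDiam e n ^ t := by
          rw [h1]; gcongr
      _ = radixDiam e n ^ (t - M) := by rw [← Real.rpow_add hD]; congr 1; ring
      _ ≤ ((1 / 2 : ℝ) ^ n) ^ (t - M) :=
          Real.rpow_le_rpow hD.le (radixDiam_le_half_pow he n) (by linarith)
      _ = ρ ^ n := by
          rw [hρ, ← Real.rpow_natCast, ← Real.rpow_mul (by norm_num), ← Real.rpow_natCast,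
            ← Real.rpow_mul (by norm_num), mul_comm]
  have hbound : ∑' s : (n : ℕ) × (∀ i : Fin n, Fin (e i.val)), ∑ v ∈ radixNbr z L s.1 s.2,
      ENNReal.ofReal (radixWt p s.1 v ^ q * radixDiam e s.1 ^ t)
      ≤ ((2 * L + 1 : ℕ) : ℝ≥0∞) * ∑' n, ENNReal.ofReal ρ ^ n := by
    rw [ENNReal.tsum_sigma fun (n : ℕ) (w : ∀ i : Fin n, Fin (e i.val)) =>
      ∑ v ∈ radixNbr z L n w, ENNReal.ofReal (radixWt p n v ^ q * radixDiam e n ^ t), ← ENNReal.tsum_mul_left]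
    refine ENNReal.tsum_le_tsum fun n => ?_
    rw [tsum_fintype, Finset.sum_comm' (t' := Finset.univ) (s' := fun v => radixNbr z L n v)
      (fun w v => by simpa using mem_radixNbr_comm)]
    refine le_trans ?_ (mul_le_mul_right (hlevel n) _)
    rw [Finset.mul_sum]
    refine Finset.sum_le_sum fun v _ => ?_
    rw [Finset.sum_const, nsmul_eq_mul]
    gcongr
    exact card_radixNbr_le z L n v
  refine ne_top_of_le_ne_top (ENNReal.mul_ne_top (ENNReal.natCast_ne_top _) ?_) hbound
  rw [ENNReal.tsum_geometric]
  refine ENNReal.inv_ne_top.2 (tsub_pos_of_lt ?_).ne'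
  rwa [ENNReal.ofReal_lt_one]

variable {c : ℕ} (he : ∀ i, 2 ≤ e i) (hc : ∀ i, e i ≤ c)
  {p : ∀ i, Fin (e i) → ℝ} (hp : ∀ i k, 0 < p i k)
  {μ : Measure (∀ n, Fin (e n))}
  (hμ : ∀ (n : ℕ) (w : ∀ i : Fin n, Fin (e i.val)),
    μ {x | radixRes n x = w} = ENNReal.ofReal (radixWt p n w))
  [MeasurableSpace X] {m : Measure X} {g : (∀ n, Fin (e n)) → X}
  (hball : ∀ x r, m (ball x r) = μ (g ⁻¹' ball x r))
  (hclosed : ∀ x r, 0 < r → m (closedBall x r) = μ (g ⁻¹' closedBall x r))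
  (hval : ∀ y z, |radixVal y - radixVal z| ≤ dist (g y) (g z))
  (hdiam : ∀ y z n, (∀ i < n, y i = z i) → dist (g y) (g z) ≤ radixDiam e n)

include he hc hball in
lemma exists_radix_approx {x : X} (hx : x ∈ msupport m) {r : ℝ} (hr : 0 < r) (hr1 : r ≤ 1) :
    ∃ n, ∃ y : ∀ n, Fin (e n), radixDiam e n ≤ r / 2 ∧ r / 2 ≤ c * radixDiam e n ∧
      dist (g y) x ≤ r / 2 := by
  have hex : ∃ n, radixDiam e n ≤ r / 2 := by
    obtain ⟨n, hn⟩ := exists_pow_lt_of_lt_one (half_pos hr) (by norm_num : (1 / 2 : ℝ) < 1)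
    exact ⟨n, (radixDiam_le_half_pow he n).trans hn.le⟩
  have hpos := hx (r / 2) (half_pos hr)
  rw [hball] at hpos
  obtain ⟨y, hy⟩ := nonempty_of_measure_ne_zero hpos.ne'
  refine ⟨Nat.find hex, y, Nat.find_spec hex, ?_, (mem_ball.1 hy).le⟩
  have h0 : Nat.find hex ≠ 0 := fun h => by
    have := Nat.find_spec hex
    rw [h] at this
    simp [radixDiam] at this
    linarith
  obtain ⟨k, hk⟩ := Nat.exists_eq_succ_of_ne_zero h0
  have hlt : r / 2 < radixDiam e k := not_le.1 (Nat.find_min hex (by omega))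
  rw [hk]
  exact hlt.le.trans (radixDiam_le_mul_succ he hc k)

include he hc hp hμ hball hclosed hval hdiam in
lemma exists_Pdel_le {q M t : ℝ} (hM : ∀ i, ∑ k, p i k ^ q ≤ (e i : ℝ) ^ M) (ht : M < t) :
    ∃ C : ℝ≥0∞, C ≠ ⊤ ∧ ∀ δ, 0 < δ → δ ≤ 1 → Pdel m q t δ (msupport m) ≤ C := by
  have hc2 : 2 ≤ c := (he 0).trans (hc 0)
  have hc2' : (2 : ℝ) ≤ c := by exact_mod_cast hc2
  let z : ∀ n, Fin (e n) := fun n => ⟨0, by have := he n; omega⟩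
  set L := 3 * c + 1 with hL
  set F : (n : ℕ) → (∀ i : Fin n, Fin (e i.val)) → ℝ≥0∞ :=
    fun n v => ENNReal.ofReal (radixWt p n v ^ q * radixDiam e n ^ t) with hF
  set C : ℝ≥0∞ := ((2 * L + 1 : ℕ) : ℝ≥0∞) ^ |q| * ENNReal.ofReal ((4 * c) ^ |t|) with hC
  refine ⟨C * ∑' s : (n : ℕ) × (∀ i : Fin n, Fin (e i.val)), ∑ v ∈ radixNbr z L s.1 s.2, F s.1 v,
    ENNReal.mul_ne_top (ENNReal.mul_ne_top (ENNReal.rpow_ne_top_of_nonneg (abs_nonneg q)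
      (ENNReal.natCast_ne_top _)) ENNReal.ofReal_ne_top)
      (tsum_radixNbr_ne_top he hp hM ht z L), fun δ hδ hδ1 => ?_⟩
  refine iSup_le fun ι => iSup_le fun _ => iSup_le fun x => iSup_le fun r => iSup_le fun hx =>
    iSup_le fun hr => iSup_le fun hd => ?_
  choose n y hn1 hn2 hy using fun i =>
    exists_radix_approx he hc hball (hx i) (hr i).1 ((hr i).2.trans hδ1)
  have hinj : Function.Injective fun i : ι =>
      (⟨n i, radixRes (n i) (y i)⟩ : (n : ℕ) × (∀ i : Fin n, Fin (e i.val))) := by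
    intro i j hij
    by_contra hne
    simp only [Sigma.mk.injEq] at hij
    obtain ⟨hnij, hres⟩ := hij
    have hagree : ∀ k < n i, y j k = y i k := by
      rw [← hnij] at hres
      exact fun k hk => (radixRes_eq_iff.1 (eq_of_heq hres) k hk).symm
    refine Set.disjoint_left.1 (hd i j hne) (?_ : g (y j) ∈ _) ?_
    · rw [mem_closedBall]
      linarith [dist_triangle (g (y j)) (g (y i)) (x i), hdiam _ _ _ hagree, hn1 i, hy i]
    · rw [mem_closedBall]
      linarith [hy j, (hr j).1]
  refine le_trans ?_ (mul_le_mul_right (ENNReal.tsum_comp_le_tsum_of_injective hinj _) _)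
  rw [olsenSum, ← ENNReal.tsum_mul_left]
  refine ENNReal.tsum_le_tsum fun i => ?_
  have hri := (hr i).1
  have hD := radixDiam_pos he (n i)
  have hlow : ENNReal.ofReal (radixWt p (n i) (radixRes (n i) (y i)))
      ≤ m (closedBall (x i) (r i)) := by
    rw [hclosed _ _ hri, ← hμ]
    refine measure_mono fun u hu => ?_
    rw [mem_preimage, mem_closedBall]
    linarith [dist_triangle (g u) (g (y i)) (x i), hdiam _ _ _ (radixRes_eq_iff.1 hu), hn1 i, hy i]
  have hup : m (closedBall (x i) (r i))
      ≤ ∑ v ∈ radixNbr z L (n i) (radixRes (n i) (y i)), ENNReal.ofReal (radixWt p (n i) v) := by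
    rw [hclosed _ _ hri]
    simp only [← hμ]
    refine le_trans (measure_mono fun u hu => ?_) (measure_biUnion_finset_le _ _)
    rw [mem_preimage, mem_closedBall] at hu
    have hdist : dist (g u) (g (y i)) ≤ (3 * c : ℕ) * radixDiam e (n i) := by
      push_cast
      linarith [dist_triangle_right (g u) (g (y i)) (x i), hn2 i, hy i]
    have h1 := radixIdx_le_add he ((hval u (y i)).trans hdist)
    have h2 := radixIdx_le_add he ((hval (y i) u).trans (by rwa [dist_comm]))
    refine mem_biUnion (x := radixRes (n i) u) ?_ rfl
    simp only [radixNbr, Finset.coe_filter, Finset.mem_univ, true_and, mem_ofPred_eq,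
      radixIdx_radixExt_radixRes]
    exact ⟨h1, h2⟩
  have hq := ENNReal_rpow_le_sum_rpow (card_radixNbr_le z L _ _) (self_mem_radixNbr z L _ _)
    hlow hup q
  have hrt : ENNReal.ofReal (2 * r i) ^ t
      ≤ ENNReal.ofReal ((4 * c) ^ |t|) * ENNReal.ofReal (radixDiam e (n i) ^ t) := by
    rw [ENNReal.ofReal_rpow_of_pos (by positivity), ← ENNReal.ofReal_mul (by positivity)]
    refine ENNReal.ofReal_le_ofReal (rpow_le_mul_rpow t hD (by positivity) (by linarith) ?_ ?_)
    · nlinarith [hn1 i]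
    · linarith [hn2 i]
  refine (mul_le_mul' hq hrt).trans (le_of_eq ?_)
  have hFv : ∀ v, F (n i) v = ENNReal.ofReal (radixWt p (n i) v) ^ q
      * ENNReal.ofReal (radixDiam e (n i) ^ t) := fun v => by
    have hw := radixWt_pos hp (n i) v
    simp only [hF]
    rw [ENNReal.ofReal_mul (by positivity), ENNReal.ofReal_rpow_of_pos hw]
  simp only [hFv, ← Finset.sum_mul, hC]
  ring

include he hp hμ hclosed hval hdiam in
lemma measure_closedBall_bounds {ε : ℝ} (hε : 0 < ε) (hεp : ∀ i k, ε ≤ p i k) {n : ℕ}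
    {y : ∀ n, Fin (e n)} (h0 : (y n).val = 0) (h1 : (y (n + 1)).val = 1)
    (h2 : (y (n + 2)).val = 0) :
    ENNReal.ofReal (ε ^ 3 * radixWt p n (radixRes n y))
        ≤ m (closedBall (g y) (radixDiam e (n + 3))) ∧
      m (closedBall (g y) (radixDiam e (n + 3)))
        ≤ ENNReal.ofReal (radixWt p n (radixRes n y)) := by
  rw [hclosed _ _ (radixDiam_pos he _)]
  constructor
  · have hw : ε ^ 3 * radixWt p n (radixRes n y) ≤ radixWt p (n + 3) (radixRes (n + 3) y) := by
      have hpos := radixWt_pos hp n (radixRes n y)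
      rw [radixWt_radixRes] at hpos
      rw [radixWt_radixRes, radixWt_radixRes, Finset.prod_range_succ, Finset.prod_range_succ,
        Finset.prod_range_succ]
      calc _ = (∏ i ∈ Finset.range n, p i (y i)) * ε * ε * ε := by ring
        _ ≤ _ := by
          have := hp n (y n)
          have := hp (n + 1) (y (n + 1))
          gcongr <;> exact hεp _ _
    refine (ENNReal.ofReal_le_ofReal hw).trans ?_
    rw [← hμ]
    exact measure_mono fun u hu => mem_closedBall.2 (hdiam _ _ _ (radixRes_eq_iff.1 hu))
  · rw [← hμ]
    refine measure_mono fun u hu => radixRes_eq_iff.2 ?_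
    exact eq_of_abs_radixVal_sub_le he h0 h1 h2 ((hval u y).trans (mem_closedBall.1 hu))

include he hc hp hμ hclosed hval hdiam in
lemma rpow_mul_rpow_le_olsen_term {ε : ℝ} (hε : 0 < ε) (hε1 : ε ≤ 1) (hεp : ∀ i k, ε ≤ p i k)
    (q t : ℝ) {n : ℕ} {y : ∀ n, Fin (e n)} (h0 : (y n).val = 0) (h1 : (y (n + 1)).val = 1)
    (h2 : (y (n + 2)).val = 0) :
    ENNReal.ofReal ((((ε ^ 3)⁻¹) ^ |q| * ((c : ℝ) ^ 3) ^ |t|)⁻¹ *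
        (radixWt p n (radixRes n y) ^ q * radixDiam e n ^ t))
      ≤ m (closedBall (g y) (radixDiam e (n + 3))) ^ q
        * ENNReal.ofReal (2 * radixDiam e (n + 3)) ^ t := by
  have hw := radixWt_pos hp n (radixRes n y)
  have hD := radixDiam_pos he n
  have hD3 := radixDiam_pos he (n + 3)
  have hc1 : (1 : ℝ) ≤ c := by exact_mod_cast one_le_two.trans ((he 0).trans (hc 0))
  obtain ⟨hlow, hup⟩ := measure_closedBall_bounds he hp hμ hclosed hval hdiam hε hεp h0 h1 h2
  have hne := ne_top_of_le_ne_top ENNReal.ofReal_ne_top hup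
  obtain ⟨β, hβ0, hβ⟩ : ∃ β : ℝ, 0 ≤ β ∧
      m (closedBall (g y) (radixDiam e (n + 3))) = ENNReal.ofReal β :=
    ⟨_, ENNReal.toReal_nonneg, (ENNReal.ofReal_toReal hne).symm⟩
  rw [hβ] at hlow hup ⊢
  rw [ENNReal.ofReal_le_ofReal_iff hβ0] at hlow
  rw [ENNReal.ofReal_le_ofReal_iff hw.le] at hup
  have hβpos : 0 < β := lt_of_lt_of_le (by positivity) hlow
  have hK : (1 : ℝ) ≤ (ε ^ 3)⁻¹ := (one_le_inv₀ (by positivity)).2 (pow_le_one₀ hε.le hε1)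
  have hq : radixWt p n (radixRes n y) ^ q ≤ ((ε ^ 3)⁻¹) ^ |q| * β ^ q := by
    refine rpow_le_mul_rpow q hβpos hw hK (hup.trans (le_mul_of_one_le_left hw.le hK)) ?_
    rw [inv_mul_eq_div, le_div_iff₀ (by positivity), mul_comm]
    exact hlow
  have hcD : radixDiam e n ≤ (c : ℝ) ^ 3 * radixDiam e (n + 3) := by
    calc radixDiam e n ≤ c * radixDiam e (n + 1) := radixDiam_le_mul_succ he hc n
      _ ≤ c * (c * (c * radixDiam e (n + 3))) := by
        gcongr
        refine (radixDiam_le_mul_succ he hc (n + 1)).trans ?_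
        gcongr
        exact radixDiam_le_mul_succ he hc (n + 2)
      _ = _ := by ring
  have ht : radixDiam e n ^ t ≤ ((c : ℝ) ^ 3) ^ |t| * (2 * radixDiam e (n + 3)) ^ t := by
    refine rpow_le_mul_rpow t (by positivity) hD (one_le_pow₀ hc1) ?_ ?_
    · refine le_trans ?_ (le_mul_of_one_le_left hD.le (one_le_pow₀ hc1))
      exact (two_mul_radixDiam_succ_le he (n + 2)).trans (radixDiam_antitone he (by omega))
    · nlinarith [one_le_pow₀ hc1 (n := 3)]
  rw [ENNReal.ofReal_rpow_of_pos hβpos, ENNReal.ofReal_rpow_of_pos (by positivity),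
    ← ENNReal.ofReal_mul (by positivity)]
  refine ENNReal.ofReal_le_ofReal ?_
  rw [inv_mul_le_iff₀ (by positivity)]
  calc _ ≤ (((ε ^ 3)⁻¹) ^ |q| * β ^ q) * (((c : ℝ) ^ 3) ^ |t| * (2 * radixDiam e (n + 3)) ^ t) := by
        gcongr
    _ = _ := by ring

include he hc hp hμ hclosed hval hdiam in
lemma Ppre_eq_top {ε : ℝ} (hε : 0 < ε) (hε1 : ε ≤ 1) (hεp : ∀ i k, ε ≤ p i k) {q t : ℝ}
    (hS : ∀ (R : ℝ) (n₀ : ℕ), ∃ n, n₀ ≤ n ∧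
      R ≤ (∏ i ∈ Finset.range n, ∑ k, p i k ^ q) * radixDiam e n ^ t)
    {E : Set X} {l : ℕ} {x : ∀ n, Fin (e n)}
    (hE : ∀ y : ∀ n, Fin (e n), (∀ i < l, y i = x i) →
      ∀ n, ∃ z, g z ∈ E ∧ ∀ i < n, z i = y i) : Ppre m q t E = ⊤ := by
  have hs : ∀ i, 0 < ∑ k, p i k ^ q := fun i =>
    Finset.sum_pos (fun k _ => Real.rpow_pos_of_pos (hp i k) q) ⟨x i, Finset.mem_univ _⟩
  let D : ∀ i, Finset (Fin (e i)) := fun i => if i < l then {x i} else Finset.univ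
  set η : ℝ := (∏ i ∈ Finset.range l, p i (x i) ^ q) / ∏ i ∈ Finset.range l, ∑ k, p i k ^ q with hη
  have hηpos : 0 < η := div_pos
    (Finset.prod_pos fun i _ => Real.rpow_pos_of_pos (hp i _) q) (Finset.prod_pos fun i _ => hs i)
  have hprod : ∀ n, l ≤ n → ∏ i ∈ Finset.range n, ∑ k ∈ D i, p i k ^ q
      = η * ∏ i ∈ Finset.range n, ∑ k, p i k ^ q := by
    intro n hn
    induction n, hn using Nat.le_induction with
    | base =>
      rw [hη, div_mul_cancel₀ _ (Finset.prod_pos fun i _ => hs i).ne']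
      refine Finset.prod_congr rfl fun i hi => ?_
      simp [D, Finset.mem_range.1 hi]
    | succ n hn ih =>
      rw [Finset.prod_range_succ, Finset.prod_range_succ, ih, mul_assoc]
      simp [D, not_lt.2 hn]
  set κ : ℝ := ((ε ^ 3)⁻¹) ^ |q| * ((c : ℝ) ^ 3) ^ |t| with hκ
  have hκpos : 0 < κ := by
    have : 0 < c := (by norm_num : 0 < 2).trans_le ((he 0).trans (hc 0))
    positivity
  have htail : ∀ n i, (if i = n + 1 then 1 else 0) < e i := fun n i => by
    have := he i
    split_ifs <;> omega
  let tail : ∀ n i, Fin (e i) := fun n i => ⟨_, htail n i⟩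
  simp only [Ppre, iInf_eq_top]
  intro δ hδ
  refine ENNReal.eq_top_of_forall_nnreal_le fun R => ?_
  obtain ⟨n₁, hn₁⟩ := exists_pow_lt_of_lt_one hδ (by norm_num : (1 / 2 : ℝ) < 1)
  obtain ⟨n, hn, hRn⟩ := hS (κ / η * R) (max l n₁)
  have hln : l ≤ n := (le_max_left _ _).trans hn
  let W := Fintype.piFinset fun i : Fin n => D i.val
  have hdense : ∀ v : W, ∃ z, g z ∈ E ∧ ∀ i < n + 3, z i = radixExt v.1 (tail n) i := by
    refine fun v => hE _ (fun i hi => ?_) _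
    have hv := Fintype.mem_piFinset.1 v.2 ⟨i, hi.trans_le hln⟩
    simp only [D, hi, if_true, Finset.mem_singleton] at hv
    simp [radixExt, hi.trans_le hln, hv]
  choose y hyE hy using hdense
  have hres : ∀ v : W, radixRes n (y v) = v.1 := fun v => by
    rw [← radixRes_radixExt v.1 (tail n)]
    exact radixRes_eq_iff.2 fun i hi => hy v i (by omega)
  have hy0 : ∀ v, (y v n).val = 0 := fun v => by
    rw [hy v n (by omega)]; simp [radixExt, tail]
  have hy1 : ∀ v, (y v (n + 1)).val = 1 := fun v => by
    rw [hy v (n + 1) (by omega)]; simp [radixExt, tail]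
  have hy2 : ∀ v, (y v (n + 2)).val = 0 := fun v => by
    rw [hy v (n + 2) (by omega)]; simp [radixExt, tail]
  have hpack : olsenSum m q t (fun v : W => g (y v)) (fun _ => radixDiam e (n + 3))
      ≤ Pdel m q t δ E := by
    refine le_iSup_of_le W <| le_iSup_of_le inferInstance <| le_iSup_of_le (fun v => g (y v)) <|
      le_iSup_of_le (fun _ => radixDiam e (n + 3)) <| le_iSup_of_le hyE <|
      le_iSup_of_le (fun _ => ⟨radixDiam_pos he _, ?_⟩) <| le_iSup_of_le (fun v w hvw => ?_) le_rfl
    · have hn₁n : n₁ ≤ n + 3 := (le_max_right _ _).trans (hn.trans (by omega))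
      exact (radixDiam_antitone he hn₁n).trans ((radixDiam_le_half_pow he n₁).trans hn₁.le)
    · refine Set.disjoint_left.2 fun u hu hu' => hvw (Subtype.ext ?_)
      rw [mem_closedBall] at hu hu'
      rw [← hres v, ← hres w]
      refine radixRes_eq_iff.2 (eq_of_abs_radixVal_sub_le_two_mul he (hy0 w) (hy1 w) (hy2 w)
        (hy0 v) (hy1 v) (hy2 v) ((hval _ _).trans ?_))
      linarith [dist_triangle_left (g (y v)) (g (y w)) u]
  refine le_trans ?_ hpack
  have hterm : ∀ v : W, ENNReal.ofReal (κ⁻¹ * (radixWt p n v.1 ^ q * radixDiam e n ^ t))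
      ≤ m (closedBall (g (y v)) (radixDiam e (n + 3))) ^ q
        * ENNReal.ofReal (2 * radixDiam e (n + 3)) ^ t := fun v => by
    have h := rpow_mul_rpow_le_olsen_term he hc hp hμ hclosed hval hdiam hε hε1 hεp q t
      (hy0 v) (hy1 v) (hy2 v)
    rwa [hres v] at h
  have hD := radixDiam_pos he n
  refine le_trans ?_ (ENNReal.tsum_le_tsum hterm)
  rw [tsum_fintype, ← ENNReal.ofReal_sum_of_nonneg fun v _ => by
      have := radixWt_pos hp n v.1; positivity,
    Finset.sum_coe_sort W fun v => κ⁻¹ * (radixWt p n v ^ q * radixDiam e n ^ t),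
    ← Finset.mul_sum, ← Finset.sum_mul, sum_radixWt_rpow hp q D n, hprod n hln,
    ← ENNReal.ofReal_coe_nnreal]
  refine ENNReal.ofReal_le_ofReal ?_
  rw [le_inv_mul_iff₀ hκpos, mul_assoc]
  rw [div_mul_eq_mul_div, div_le_iff₀ hηpos] at hRn
  linarith

include he hc hp hμ hball hclosed hval hdiam in
lemma Pmeas_ne_zero {ε : ℝ} (hε : 0 < ε) (hε1 : ε ≤ 1) (hεp : ∀ i k, ε ≤ p i k) {q t : ℝ}
    (hS : ∀ (R : ℝ) (n₀ : ℕ), ∃ n, n₀ ≤ n ∧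
      R ≤ (∏ i ∈ Finset.range n, ∑ k, p i k ^ q) * radixDiam e n ^ t) :
    Pmeas m q t (msupport m) ≠ 0 := by
  have hsupp : ∀ x, g x ∈ msupport m := by
    intro x r hr
    obtain ⟨n, hn⟩ := exists_pow_lt_of_lt_one hr (by norm_num : (1 / 2 : ℝ) < 1)
    rw [hball]
    refine lt_of_lt_of_le ?_ (measure_mono (s := {u | radixRes n u = radixRes n x}) fun u hu => ?_)
    · rw [hμ]
      exact ENNReal.ofReal_pos.2 (radixWt_pos hp n _)
    · exact mem_ball.2 ((hdiam _ _ _ (radixRes_eq_iff.1 hu)).trans_lt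
        ((radixDiam_le_half_pow he n).trans_lt hn))
  suffices h : Pmeas m q t (msupport m) = ⊤ by simp [h]
  simp only [Pmeas, iInf_eq_top]
  intro En hEn
  obtain ⟨k, l, x, hx⟩ := exists_dense_in_cylinder he (fun k => g ⁻¹' En k)
    fun x => by simpa using hEn (hsupp x)
  exact ENNReal.tsum_eq_top_of_eq_top
    ⟨k, Ppre_eq_top he hc hp hμ hclosed hval hdiam hε hε1 hεp hS hx⟩

include he hc hp hμ hball hclosed hval hdiam in
lemma BFun_eq_of_radix {ε : ℝ} (hε : 0 < ε) (hε1 : ε ≤ 1) (hεp : ∀ i k, ε ≤ p i k) {q M : ℝ}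
    (hM : ∀ i, ∑ k, p i k ^ q ≤ (e i : ℝ) ^ M)
    (hS : ∀ t < M, ∀ (R : ℝ) (n₀ : ℕ), ∃ n, n₀ ≤ n ∧
      R ≤ (∏ i ∈ Finset.range n, ∑ k, p i k ^ q) * radixDiam e n ^ t) :
    BFun m q = M := by
  refine BFun_eq_of_forall (fun t ht => ?_) fun t ht =>
    Pmeas_ne_zero he hc hp hμ hball hclosed hval hdiam hε hε1 hεp (hS t ht)
  obtain ⟨C, hC, h⟩ := exists_Pdel_le he hc hp hμ hball hclosed hval hdiam hM
    (t := (M + t) / 2) (by linarith)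
  exact Pmeas_eq_zero_of_Pdel_le (by linarith) hC h

end RadixMeasure

/-! ### The mixed symbolic space -/

lemma le_apply_of_strictMono_from_one {T : ℕ → ℕ} (hT1 : T 1 = 1)
    (hT : ∀ k, 1 ≤ k → T k < T (k + 1)) {k : ℕ} (hk : 1 ≤ k) : k ≤ T k := by
  induction k, hk using Nat.le_induction with
  | base => exact hT1.ge
  | succ k hk ih => exact Nat.succ_le_of_lt (ih.trans_lt (hT k hk))

lemma monotoneOn_of_strictMono_from_one {T : ℕ → ℕ} (hT : ∀ k, 1 ≤ k → T k < T (k + 1))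
    {j k : ℕ} (hj : 1 ≤ j) (hjk : j ≤ k) : T j ≤ T k := by
  induction k, hjk using Nat.le_induction with
  | base => exact le_rfl
  | succ k hjk ih => exact ih.trans (hT k (hj.trans hjk)).le

/-- Products of factors bounded below are unbounded when infinitely many of the rapidly growing
blocks `[T k, T (k + 1))` consist of factors larger than some `lam > 1`. -/
lemma exists_le_prod_of_blocks {T : ℕ → ℕ} (hT1 : T 1 = 1) (hT : ∀ k, 1 ≤ k → T k < T (k + 1))
    (hTrat : Tendsto (fun k => (T (k + 1) : ℝ) / (T k : ℝ)) atTop atTop)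
    {f : ℕ → ℝ} {ρ lam : ℝ} (hρ : 0 < ρ) (hρ1 : ρ ≤ 1) (hlam : 1 < lam) (hf : ∀ i, ρ ≤ f i)
    (hblock : ∀ k₀, ∃ k, k₀ ≤ k ∧ ∀ i, T k ≤ i + 1 → i + 1 < T (k + 1) → lam ≤ f i)
    (R : ℝ) (n₀ : ℕ) : ∃ n, n₀ ≤ n ∧ R ≤ ∏ i ∈ Finset.range n, f i := by
  obtain ⟨s, hs⟩ := pow_unbounded_of_one_lt (2 / ρ) hlam
  obtain ⟨k₁, hk₁⟩ := eventually_atTop.1 (hTrat.eventually_ge_atTop ((s : ℝ) + 1))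
  obtain ⟨k₂, hk₂⟩ := pow_unbounded_of_one_lt R (one_lt_two : (1 : ℝ) < 2)
  obtain ⟨k, hk, hkf⟩ := hblock (k₁ + k₂ + n₀ + 1)
  have hTk := le_apply_of_strictMono_from_one hT1 hT (k := k) (by omega)
  have hTk' := le_apply_of_strictMono_from_one hT1 hT (k := k + 1) (by omega)
  have hratio : (s + 1) * T k ≤ T (k + 1) := by
    have h := hk₁ k (by omega)
    rw [le_div_iff₀ (by exact_mod_cast (by omega : 0 < T k))] at h
    exact_mod_cast h
  have hlt := hT k (by omega)
  refine ⟨T (k + 1) - 1, by omega, ?_⟩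
  rw [← Finset.prod_range_mul_prod_Ico f (by omega : T k - 1 ≤ T (k + 1) - 1)]
  have h1 : ρ ^ (T k - 1) ≤ ∏ i ∈ Finset.range (T k - 1), f i := by
    have := Finset.prod_le_prod (s := Finset.range (T k - 1)) (fun _ _ => hρ.le) fun i _ => hf i
    simpa using this
  have h2 : lam ^ (T (k + 1) - T k) ≤ ∏ i ∈ Finset.Ico (T k - 1) (T (k + 1) - 1), f i := by
    have := Finset.prod_le_prod (s := Finset.Ico (T k - 1) (T (k + 1) - 1))
      (f := fun _ => lam) (g := f) (fun _ _ => by linarith) fun i hi => by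
        rw [Finset.mem_Ico] at hi
        exact hkf i (by omega) (by omega)
    rwa [Finset.prod_const, Nat.card_Ico,
      show T (k + 1) - 1 - (T k - 1) = T (k + 1) - T k by omega] at this
  have h3 : (2 : ℝ) ≤ ρ * lam ^ s := by
    rw [div_lt_iff₀ hρ] at hs
    linarith
  calc R ≤ 2 ^ k₂ := hk₂.le
    _ ≤ 2 ^ T k := pow_le_pow_right₀ one_le_two (by omega)
    _ ≤ (ρ * lam ^ s) ^ T k := pow_le_pow_left₀ zero_le_two h3 _
    _ = ρ ^ T k * lam ^ (s * T k) := by rw [mul_pow, pow_mul]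
    _ ≤ ρ ^ (T k - 1) * lam ^ (T (k + 1) - T k) := by
      refine mul_le_mul (pow_le_pow_of_le_one hρ.le hρ1 (by omega))
        (pow_le_pow_right₀ hlam.le ?_) (by positivity) (by positivity)
      rw [add_mul, one_mul] at hratio
      omega
    _ ≤ _ := mul_le_mul h1 h2 (by positivity) ((by positivity : 0 ≤ ρ ^ (T k - 1)).trans h1)

lemma isA_of_mem_block {T : ℕ → ℕ} {k j : ℕ} (hk : 1 ≤ k) (h1 : T (2 * k - 1) ≤ j)
    (h2 : j < T (2 * k)) : isA T j :=
  ⟨k, hk, h1, h2⟩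

lemma not_isA_of_mem_block {T : ℕ → ℕ} (hT : ∀ k, 1 ≤ k → T k < T (k + 1)) {k j : ℕ} (hk : 1 ≤ k)
    (h1 : T (2 * k) ≤ j) (h2 : j < T (2 * k + 1)) : ¬ isA T j := by
  rintro ⟨k', hk', h3, h4⟩
  rcases le_or_gt k' k with h | h
  · have := monotoneOn_of_strictMono_from_one hT (by omega : 1 ≤ 2 * k')
      (by omega : 2 * k' ≤ 2 * k)
    omega
  · have := monotoneOn_of_strictMono_from_one hT (by omega : 1 ≤ 2 * k + 1)
      (by omega : 2 * k + 1 ≤ 2 * k' - 1)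
    omega

lemma Dw_eq_radixDiam (c₁ c₂ : ℕ) (T : ℕ → ℕ) (n : ℕ) :
    Dw c₁ c₂ T n = radixDiam (Yc c₁ c₂ T) n := by
  have hle : ∀ n, Ncount T n ≤ n := fun n =>
    (Finset.card_filter_le _ _).trans (by simp)
  have hsucc : ∀ n, Ncount T (n + 1) = Ncount T n + if isA T (n + 1) then 1 else 0 := fun n => by
    simp only [Ncount, Finset.card_filter]
    rw [Finset.sum_Icc_succ_top (by omega)]
  induction n with
  | zero => simp [Dw, radixDiam, Ncount]
  | succ n ih =>
    rw [radixDiam_succ, ← ih, Dw, Dw, ← mul_inv, hsucc]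
    congr 1
    by_cases h : isA T (n + 1)
    · simp only [h, if_true, Yc]
      rw [show n + 1 - (Ncount T n + 1) = n - Ncount T n by omega]
      ring
    · simp only [h, if_false, Yc, add_zero]
      rw [Nat.succ_sub (hle n), pow_succ]
      ring

lemma gammaMap_eq_radixVal (c₁ c₂ : ℕ) (T : ℕ → ℕ) : gammaMap c₁ c₂ T = radixVal := by
  funext x
  simp only [gammaMap, radixVal, Dw_eq_radixDiam]

lemma exists_pos_le_of_forall_pos {c : ℕ} (hc : 0 < c) {a : ℕ → ℝ}
    (ha : ∀ i, i < c → 0 < a i ∧ a i < 1) : ∃ ε, 0 < ε ∧ ε ≤ 1 ∧ ∀ i < c, ε ≤ a i := by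
  obtain ⟨j, hj, hmin⟩ := Finset.exists_min_image (Finset.range c) a ⟨0, Finset.mem_range.2 hc⟩
  have hj' := ha j (Finset.mem_range.1 hj)
  exact ⟨a j, hj'.1, hj'.2.le, fun i hi => hmin i (Finset.mem_range.2 hi)⟩

lemma rpow_theta {c : ℕ} (hc : 2 ≤ c) {a : ℕ → ℝ} (ha : ∀ i, i < c → 0 < a i ∧ a i < 1) (q : ℝ) :
    (c : ℝ) ^ theta c a q = ∑ i ∈ Finset.range c, a i ^ q := by
  have hc' : (2 : ℝ) ≤ c := by exact_mod_cast hc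
  refine Real.rpow_logb (by linarith) (by linarith) (Finset.sum_pos (fun i hi => ?_)
    ⟨0, Finset.mem_range.2 (by omega)⟩)
  exact Real.rpow_pos_of_pos (ha i (Finset.mem_range.1 hi)).1 q

section Mixed

variable {c₁ c₂ : ℕ} {T : ℕ → ℕ} (hc₁ : 2 ≤ c₁) (hc₂ : 2 ≤ c₂) {a b : ℕ → ℝ}
  (ha : ∀ i, i < c₁ → 0 < a i ∧ a i < 1) (hb : ∀ j, j < c₂ → 0 < b j ∧ b j < 1)

include hc₁ hc₂ ha hb in
lemma sum_weight_rpow (i : ℕ) (q : ℝ) :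
    ∑ k : Fin (Yc c₁ c₂ T i), (if isA T (i + 1) then a k.val else b k.val) ^ q
      = (Yc c₁ c₂ T i : ℝ) ^ (if isA T (i + 1) then theta c₁ a q else theta c₂ b q) := by
  rw [Fin.sum_univ_eq_sum_range fun k => (if isA T (i + 1) then a k else b k) ^ q]
  by_cases h : isA T (i + 1)
  · simp only [Yc, h, if_true, rpow_theta hc₁ ha]
  · simp only [Yc, h, if_false, rpow_theta hc₂ hb]

include hc₁ hc₂ ha hb in
lemma exists_le_prod_weight (hT1 : T 1 = 1) (hT : ∀ k, 1 ≤ k → T k < T (k + 1))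
    (hTrat : Tendsto (fun k => (T (k + 1) : ℝ) / (T k : ℝ)) atTop atTop) (q : ℝ) {t : ℝ}
    (ht : t < max (theta c₁ a q) (theta c₂ b q)) (R : ℝ) (n₀ : ℕ) : ∃ n, n₀ ≤ n ∧
      R ≤ (∏ i ∈ Finset.range n,
        ∑ k : Fin (Yc c₁ c₂ T i), (if isA T (i + 1) then a k.val else b k.val) ^ q)
          * radixDiam (Yc c₁ c₂ T) n ^ t := by
  have h₁ : (1 : ℝ) < c₁ := by exact_mod_cast hc₁
  have h₂ : (1 : ℝ) < c₂ := by exact_mod_cast hc₂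
  set u : ℝ := (c₁ : ℝ) ^ (theta c₁ a q - t) with hu
  set v : ℝ := (c₂ : ℝ) ^ (theta c₂ b q - t) with hv
  have hu0 : 0 < u := by positivity
  have hv0 : 0 < v := by positivity
  have hprod : ∀ n, (∏ i ∈ Finset.range n,
      ∑ k : Fin (Yc c₁ c₂ T i), (if isA T (i + 1) then a k.val else b k.val) ^ q)
        * radixDiam (Yc c₁ c₂ T) n ^ t
      = ∏ i ∈ Finset.range n, if isA T (i + 1) then u else v := by
    intro n
    rw [radixDiam, ← Real.finsetProd_rpow _ _ fun i _ => by positivity, ← Finset.prod_mul_distrib]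
    refine Finset.prod_congr rfl fun i _ => ?_
    rw [sum_weight_rpow hc₁ hc₂ ha hb, Real.inv_rpow (by positivity),
      ← Real.rpow_neg (by positivity)]
    by_cases h : isA T (i + 1)
    · simp only [Yc, h, if_true, hu]
      rw [← Real.rpow_add (by positivity), sub_eq_add_neg]
    · simp only [Yc, h, if_false, hv]
      rw [← Real.rpow_add (by positivity), sub_eq_add_neg]
  simp only [hprod]
  have hmain : ∀ lam, 1 < lam → (∀ k₀, ∃ k, k₀ ≤ k ∧ ∀ i, T k ≤ i + 1 → i + 1 < T (k + 1) →
      lam ≤ if isA T (i + 1) then u else v) →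
      ∃ n, n₀ ≤ n ∧ R ≤ ∏ i ∈ Finset.range n, if isA T (i + 1) then u else v := by
    intro lam hlam hblock
    refine exists_le_prod_of_blocks hT1 hT hTrat (ρ := min 1 (min u v))
      (lt_min one_pos (lt_min hu0 hv0)) (min_le_left _ _) hlam (fun i => ?_) hblock R n₀
    split_ifs
    · exact (min_le_right _ _).trans (min_le_left _ _)
    · exact (min_le_right _ _).trans (min_le_right _ _)
  rcases lt_max_iff.1 ht with ht | ht
  · refine hmain u (Real.one_lt_rpow h₁ (sub_pos.2 ht)) fun k₀ =>
      ⟨2 * (k₀ + 1) - 1, by omega, fun i hi1 hi2 => ?_⟩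
    rw [show 2 * (k₀ + 1) - 1 + 1 = 2 * (k₀ + 1) by omega] at hi2
    rw [if_pos (isA_of_mem_block (by omega) hi1 hi2)]
  · refine hmain v (Real.one_lt_rpow h₂ (sub_pos.2 ht)) fun k₀ =>
      ⟨2 * (k₀ + 1), by omega, fun i hi1 hi2 => ?_⟩
    rw [if_neg (not_isA_of_mem_block hT (by omega) hi1 hi2)]

include hc₁ hc₂ ha hb in
lemma BFun_eq_max_theta (hT1 : T 1 = 1) (hT : ∀ k, 1 ≤ k → T k < T (k + 1))
    (hTrat : Tendsto (fun k => (T (k + 1) : ℝ) / (T k : ℝ)) atTop atTop)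
    {μ : Measure (∀ n, Fin (Yc c₁ c₂ T n))}
    (hμ : ∀ (n : ℕ) (w : Word c₁ c₂ T n),
      μ (cyl c₁ c₂ T n w) = ENNReal.ofReal (cylWeight c₁ c₂ T a b n w)) (q : ℝ)
    [MeasurableSpace X] {m : Measure X} {g : (∀ n, Fin (Yc c₁ c₂ T n)) → X}
    (hball : ∀ x r, m (ball x r) = μ (g ⁻¹' ball x r))
    (hclosed : ∀ x r, 0 < r → m (closedBall x r) = μ (g ⁻¹' closedBall x r))
    (hval : ∀ y z, |radixVal y - radixVal z| ≤ dist (g y) (g z))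
    (hdiam : ∀ y z n, (∀ i < n, y i = z i) →
      dist (g y) (g z) ≤ radixDiam (Yc c₁ c₂ T) n) :
    BFun m q = max (theta c₁ a q) (theta c₂ b q) := by
  obtain ⟨ε₁, hε₁, hε₁1, hεa⟩ := exists_pos_le_of_forall_pos (by omega) ha
  obtain ⟨ε₂, hε₂, hε₂1, hεb⟩ := exists_pos_le_of_forall_pos (by omega) hb
  have hεp : ∀ i (k : Fin (Yc c₁ c₂ T i)),
      min ε₁ ε₂ ≤ if isA T (i + 1) then a k.val else b k.val := by
    intro i k
    have hk := k.2
    unfold Yc at hk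
    split_ifs at hk ⊢
    · exact (min_le_left _ _).trans (hεa _ hk)
    · exact (min_le_right _ _).trans (hεb _ hk)
  have hε := lt_min hε₁ hε₂
  have he : ∀ i, 2 ≤ Yc c₁ c₂ T i := fun i => by unfold Yc; split_ifs <;> assumption
  have hc : ∀ i, Yc c₁ c₂ T i ≤ max c₁ c₂ := fun i => by
    unfold Yc; split_ifs; exacts [le_max_left _ _, le_max_right _ _]
  refine BFun_eq_of_radix he hc (p := fun i k => if isA T (i + 1) then a k.val else b k.val)
    (fun i k => hε.trans_le (hεp i k)) (fun n w => ?_) hball hclosed hval hdiam hε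
    ((min_le_left _ _).trans hε₁1) hεp (fun i => ?_)
    fun t ht => exists_le_prod_weight hc₁ hc₂ ha hb hT1 hT hTrat q ht
  · rw [← show _ = ENNReal.ofReal (radixWt _ n w) from hμ n w]
    congr 1
    ext x
    exact funext_iff
  · rw [sum_weight_rpow hc₁ hc₂ ha hb]
    refine Real.rpow_le_rpow_of_exponent_le ?_ ?_
    · exact_mod_cast one_le_two.trans (he i)
    · split_ifs
      exacts [le_max_left _ _, le_max_right _ _]

end Mixed

/-- `B_ν(q) = B_μ(q) = max(θ_a(q), θ_b(q))`. -/
theorem stmt6 (c₁ c₂ : ℕ) (hc₁ : 2 ≤ c₁) (hc₂ : 2 ≤ c₂)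
    (T : ℕ → ℕ) (hT1 : T 1 = 1) (hTmono : ∀ k, 1 ≤ k → T k < T (k + 1))
    (hTrat : Tendsto (fun k => (T (k + 1) : ℝ) / (T k : ℝ)) atTop atTop)
    (a b : ℕ → ℝ) (ha : ∀ i, i < c₁ → 0 < a i ∧ a i < 1)
    (hb : ∀ j, j < c₂ → 0 < b j ∧ b j < 1)
    (hsa : ∑ i ∈ Finset.range c₁, a i = 1) (hsb : ∑ j ∈ Finset.range c₂, b j = 1)
    [MetricSpace (Omg c₁ c₂ T)]
    (hdist : ∀ (x y : Omg c₁ c₂ T) (n : ℕ), (∀ i, i < n → x i = y i) → x n ≠ y n →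
      dist x y = Dw c₁ c₂ T n)
    (μ : Measure (Omg c₁ c₂ T)) [IsProbabilityMeasure μ]
    (hμ : ∀ (n : ℕ) (w : Word c₁ c₂ T n),
      μ (cyl c₁ c₂ T n w) = ENNReal.ofReal (cylWeight c₁ c₂ T a b n w))
    (q : ℝ) :
    BFun (μ.map (gammaMap c₁ c₂ T)) q = BFun μ q ∧
    BFun μ q = max (theta c₁ a q) (theta c₂ b q) := by
  have he : ∀ i, 2 ≤ Yc c₁ c₂ T i := fun i => by unfold Yc; split_ifs <;> assumption
  have hfirst : ∀ {y z : Omg c₁ c₂ T}, y ≠ z → ∃ n, (∀ i < n, y i = z i) ∧ y n ≠ z n ∧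
      dist y z = radixDiam (Yc c₁ c₂ T) n := fun {y z} hyz => by
    have hex : ∃ n, y n ≠ z n := Function.ne_iff.1 hyz
    have hlt : ∀ i < Nat.find hex, y i = z i := fun i hi => not_not.1 (Nat.find_min hex hi)
    exact ⟨_, hlt, Nat.find_spec hex,
      (hdist y z _ hlt (Nat.find_spec hex)).trans (Dw_eq_radixDiam _ _ _ _)⟩
  have hBμ : BFun μ q = max (theta c₁ a q) (theta c₂ b q) := by
    refine BFun_eq_max_theta hc₁ hc₂ ha hb hT1 hTmono hTrat hμ q (g := id) (fun _ _ => rfl)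
      (fun _ _ _ => rfl) (fun y z => ?_) fun y z n h => ?_
    · rcases eq_or_ne y z with rfl | hyz
      · simp
      · obtain ⟨n, hn, -, hd⟩ := hfirst hyz
        exact (abs_radixVal_sub_le he hn).trans hd.ge
    · rcases eq_or_ne y z with rfl | hyz
      · simpa using (radixDiam_pos he n).le
      · obtain ⟨k, -, hk, hd⟩ := hfirst hyz
        refine hd.le.trans (radixDiam_antitone he (not_lt.1 fun hkn => hk (h k hkn)))
  refine ⟨?_, hBμ⟩
  rw [hBμ, gammaMap_eq_radixVal]
  refine BFun_eq_max_theta hc₁ hc₂ ha hb hT1 hTmono hTrat hμ q (g := radixVal)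
    (fun _ _ => Measure.map_apply (measurable_radixVal he) measurableSet_ball)
    (fun _ _ _ => Measure.map_apply (measurable_radixVal he) measurableSet_closedBall)
    (fun y z => (Real.dist_eq _ _).ge) fun y z n h => ?_
  rw [Real.dist_eq]
  exact abs_radixVal_sub_le he h

end MF
end
end

section
/- For every $q\in\mathbb{R}$ and every $\varepsilon>0$, $\mathscr{H}^{q,\underline{\tau}_\mu(q)+\varepsilon}_\nu([0,1])\le1$; consequently $b_\nu(q)\le\underline{\tau}_\mu(q)$. -/
open MeasureTheory Metric Set Filter Topology Classical
open scoped ENNReal NNReal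

noncomputable section

namespace MF

/-! ### Olsen's multifractal measures and dimension functions on a metric space -/

variable {X : Type} [MetricSpace X]

/-! ### Mixed-radix grids of the unit interval -/

/-- The number `∏ i < n, Y i` of words of length `n` over the alphabets `Fin (Y i)`. -/
def gridCard (Y : ℕ → ℕ) (n : ℕ) : ℕ := ∏ i ∈ Finset.range n, Y i

/-- The integer whose mixed-radix digits, most significant first, are `f 0, …, f (n - 1)`. -/
def gridIdx (Y f : ℕ → ℕ) : ℕ → ℕ
  | 0 => 0
  | n + 1 => gridIdx Y f n * Y n + f n

/-- The position of a finite word in the lexicographic order. -/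
def wordIdx (Y : ℕ → ℕ) {n : ℕ} (w : ∀ i : Fin n, Fin (Y i)) : ℕ :=
  gridIdx Y (fun i => if h : i < n then (w ⟨i, h⟩).val else 0) n

/-- The number in `[0, 1]` with given mixed-radix digits. -/
def radixSum (Y : ℕ → ℕ) (x : ∀ n, Fin (Y n)) : ℝ :=
  ∑' n, ((x n).val : ℝ) * ((gridCard Y (n + 1) : ℝ))⁻¹

/-- The grid interval of generation `n` and index `k`. -/
def gridIcc (Y : ℕ → ℕ) (n k : ℕ) : Set ℝ :=
  Icc ((k : ℝ) * (gridCard Y n : ℝ)⁻¹) (((k : ℝ) + 1) * (gridCard Y n : ℝ)⁻¹)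

/-- The words of length `n` whose position is at distance at most two from that of `w`. -/
def nearWords (Y : ℕ → ℕ) {n : ℕ} (w : ∀ i : Fin n, Fin (Y i)) :
    Finset (∀ i : Fin n, Fin (Y i)) :=
  Finset.univ.filter fun v => wordIdx Y v ≤ wordIdx Y w + 2 ∧ wordIdx Y w ≤ wordIdx Y v + 2

lemma gridCard_succ (Y : ℕ → ℕ) (n : ℕ) : gridCard Y (n + 1) = gridCard Y n * Y n :=
  Finset.prod_range_succ _ _

lemma two_pow_le_gridCard {Y : ℕ → ℕ} (hY : ∀ n, 2 ≤ Y n) (n : ℕ) : 2 ^ n ≤ gridCard Y n := by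
  induction n with
  | zero => simp [gridCard]
  | succ n ih => rw [gridCard_succ, pow_succ]; exact Nat.mul_le_mul ih (hY n)

lemma gridCard_pos {Y : ℕ → ℕ} (hY : ∀ n, 2 ≤ Y n) (n : ℕ) : 0 < gridCard Y n :=
  lt_of_lt_of_le (by positivity) (two_pow_le_gridCard hY n)

lemma tendsto_gridCard {Y : ℕ → ℕ} (hY : ∀ n, 2 ≤ Y n) :
    Tendsto (fun n => (gridCard Y n : ℝ)) atTop atTop :=
  tendsto_atTop_mono (fun n => by exact_mod_cast two_pow_le_gridCard hY n)
    (tendsto_pow_atTop_atTop_of_one_lt (one_lt_two : (1 : ℝ) < 2))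

lemma gridIdx_congr {Y f g : ℕ → ℕ} {n : ℕ} (h : ∀ i < n, f i = g i) :
    gridIdx Y f n = gridIdx Y g n := by
  induction n with
  | zero => rfl
  | succ n ih =>
    simp only [gridIdx]
    rw [ih fun i hi => h i (by omega), h n (by omega)]

lemma gridIdx_lt {Y f : ℕ → ℕ} {n : ℕ} (h : ∀ i < n, f i < Y i) :
    gridIdx Y f n < gridCard Y n := by
  induction n with
  | zero => simp [gridIdx, gridCard]
  | succ n ih =>
    have h1 := ih fun i hi => h i (by omega)
    have h2 := h n (by omega)
    rw [gridCard_succ]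
    simp only [gridIdx]
    calc gridIdx Y f n * Y n + f n < (gridIdx Y f n + 1) * Y n := by
          rw [add_mul, one_mul]; omega
      _ ≤ _ := Nat.mul_le_mul_right _ h1

lemma gridIdx_injective {Y f g : ℕ → ℕ} {n : ℕ} (hf : ∀ i < n, f i < Y i)
    (hg : ∀ i < n, g i < Y i) (h : gridIdx Y f n = gridIdx Y g n) : ∀ i < n, f i = g i := by
  induction n with
  | zero => intro i hi; omega
  | succ n ih =>
    have hfn := hf n (by omega)
    have hgn := hg n (by omega)
    have hY : 0 < Y n := by omega
    simp only [gridIdx] at h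
    have hd := congrArg (· / Y n) h
    have hm := congrArg (· % Y n) h
    simp only [Nat.mul_comm _ (Y n), Nat.mul_add_div hY, Nat.div_eq_of_lt hfn,
      Nat.div_eq_of_lt hgn, Nat.mul_add_mod, Nat.mod_eq_of_lt hfn, Nat.mod_eq_of_lt hgn,
      add_zero] at hd hm
    intro i hi
    rcases Nat.lt_succ_iff_lt_or_eq.mp hi with hi | rfl
    · exact ih (fun j hj => hf j (by omega)) (fun j hj => hg j (by omega)) hd i hi
    · exact hm

lemma wordIdx_restrict (Y : ℕ → ℕ) (n : ℕ) (x : ∀ i, Fin (Y i)) :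
    wordIdx Y (fun i : Fin n => x i) = gridIdx Y (fun i => (x i).val) n :=
  gridIdx_congr fun i hi => by simp [hi]

lemma wordIdx_lt (Y : ℕ → ℕ) {n : ℕ} (w : ∀ i : Fin n, Fin (Y i)) :
    wordIdx Y w < gridCard Y n :=
  gridIdx_lt fun i hi => by simp [hi]

lemma wordIdx_injective (Y : ℕ → ℕ) (n : ℕ) :
    Function.Injective (wordIdx Y : (∀ i : Fin n, Fin (Y i)) → ℕ) := by
  intro v w h
  have := gridIdx_injective (fun i hi => by simp [hi]) (fun i hi => by simp [hi]) h
  funext i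
  have := this i i.2
  simp only [i.2, dite_true] at this
  exact Fin.ext this

lemma exists_wordIdx_eq (Y : ℕ → ℕ) {n k : ℕ} (hk : k < gridCard Y n) :
    ∃ w : ∀ i : Fin n, Fin (Y i), wordIdx Y w = k := by
  let φ : (∀ i : Fin n, Fin (Y i)) → Fin (gridCard Y n) := fun w => ⟨wordIdx Y w, wordIdx_lt Y w⟩
  have hφ : Function.Bijective φ := by
    rw [Fintype.bijective_iff_injective_and_card]
    refine ⟨fun v w h => wordIdx_injective Y n (congrArg Fin.val h), ?_⟩
    rw [Fintype.card_pi, Fintype.card_fin, gridCard, ← Fin.prod_univ_eq_prod_range]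
    simp
  obtain ⟨w, hw⟩ := hφ.2 ⟨k, hk⟩
  exact ⟨w, congrArg Fin.val hw⟩

lemma exists_mem_gridIcc {Y : ℕ → ℕ} (hY : ∀ n, 2 ≤ Y n) (n : ℕ) {x : ℝ} (hx : x ∈ Icc (0 : ℝ) 1) :
    ∃ w : ∀ i : Fin n, Fin (Y i), x ∈ gridIcc Y n (wordIdx Y w) := by
  have hM : (0 : ℝ) < gridCard Y n := by exact_mod_cast gridCard_pos hY n
  suffices ∃ k < gridCard Y n, (k : ℝ) ≤ x * gridCard Y n ∧ x * gridCard Y n ≤ k + 1 by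
    obtain ⟨k, hk, h1, h2⟩ := this
    obtain ⟨w, rfl⟩ := exists_wordIdx_eq Y hk
    exact ⟨w, by rwa [← div_eq_mul_inv, div_le_iff₀ hM],
      by rwa [← div_eq_mul_inv, le_div_iff₀ hM]⟩
  rcases hx.2.eq_or_lt with rfl | hx1
  · refine ⟨gridCard Y n - 1, Nat.sub_lt (gridCard_pos hY n) one_pos, ?_, ?_⟩ <;>
      rw [Nat.cast_pred (gridCard_pos hY n)] <;> simp
  · have h0 : 0 ≤ x * gridCard Y n := mul_nonneg hx.1 hM.le
    refine ⟨⌊x * gridCard Y n⌋₊, ?_, Nat.floor_le h0, (Nat.lt_floor_add_one _).le⟩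
    rw [Nat.floor_lt h0]
    nlinarith

lemma sum_range_digits {Y : ℕ → ℕ} (hY : ∀ n, 2 ≤ Y n) (f : ℕ → ℕ) (n : ℕ) :
    ∑ i ∈ Finset.range n, (f i : ℝ) * (gridCard Y (i + 1) : ℝ)⁻¹
      = gridIdx Y f n * (gridCard Y n : ℝ)⁻¹ := by
  induction n with
  | zero => simp [gridIdx]
  | succ n ih =>
    have hM : (gridCard Y n : ℝ) ≠ 0 := by exact_mod_cast (gridCard_pos hY n).ne'
    have hYn : (Y n : ℝ) ≠ 0 := by have := hY n; exact_mod_cast (by omega : Y n ≠ 0)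
    rw [Finset.sum_range_succ, ih, gridCard_succ]
    simp only [gridIdx]
    push_cast
    field_simp

lemma antitone_digits_add {Y : ℕ → ℕ} (hY : ∀ n, 2 ≤ Y n) (x : ∀ n, Fin (Y n)) :
    Antitone fun n => ∑ i ∈ Finset.range n, ((x i).val : ℝ) * (gridCard Y (i + 1) : ℝ)⁻¹
      + (gridCard Y n : ℝ)⁻¹ := by
  refine antitone_nat_of_succ_le fun n => ?_
  have hM : (0 : ℝ) < gridCard Y n := by exact_mod_cast gridCard_pos hY n
  have hYn : (0 : ℝ) < Y n := by have := hY n; exact_mod_cast (by omega : 0 < Y n)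
  have hx : ((x n).val : ℝ) + 1 ≤ Y n := by exact_mod_cast (x n).2
  rw [Finset.sum_range_succ, gridCard_succ, add_assoc]
  gcongr
  push_cast
  calc ((x n).val : ℝ) * ((gridCard Y n : ℝ) * Y n)⁻¹ + ((gridCard Y n : ℝ) * Y n)⁻¹
      = ((x n).val + 1) * ((gridCard Y n : ℝ) * Y n)⁻¹ := by ring
    _ ≤ Y n * ((gridCard Y n : ℝ) * Y n)⁻¹ := by gcongr
    _ = (gridCard Y n : ℝ)⁻¹ := by field_simp

lemma summable_digits {Y : ℕ → ℕ} (hY : ∀ n, 2 ≤ Y n) (x : ∀ n, Fin (Y n)) :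
    Summable fun n => ((x n).val : ℝ) * (gridCard Y (n + 1) : ℝ)⁻¹ := by
  refine summable_of_sum_range_le (c := 1) (fun n => by positivity) fun n => ?_
  have h := antitone_digits_add hY x (Nat.zero_le n)
  simp only [Finset.range_zero, Finset.sum_empty, zero_add] at h
  have h0 : (gridCard Y 0 : ℝ)⁻¹ = 1 := by simp [gridCard]
  have hM : (0 : ℝ) ≤ (gridCard Y n : ℝ)⁻¹ := by positivity
  linarith

lemma radixSum_mem_gridIcc {Y : ℕ → ℕ} (hY : ∀ n, 2 ≤ Y n) (n : ℕ) (x : ∀ n, Fin (Y n)) :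
    radixSum Y x ∈ gridIcc Y n (wordIdx Y fun i : Fin n => x i) := by
  have hs := summable_digits hY x
  rw [wordIdx_restrict, gridIcc, add_mul, one_mul,
    ← sum_range_digits hY (fun i => (x i).val) n]
  refine ⟨hs.sum_le_tsum _ fun i _ => by positivity, ?_⟩
  refine le_of_tendsto hs.hasSum.tendsto_sum_nat ?_
  filter_upwards [eventually_ge_atTop n] with m hm
  refine le_trans ?_ (antitone_digits_add hY x hm)
  exact le_add_of_nonneg_right (by positivity)

lemma measurable_radixSum {Y : ℕ → ℕ} (hY : ∀ n, 2 ≤ Y n) : Measurable (radixSum Y) := by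
  refine measurable_of_tendsto_metrizable
    (f := fun n x => ∑ i ∈ Finset.range n, ((x i).val : ℝ) * (gridCard Y (i + 1) : ℝ)⁻¹)
    (fun n => ?_) ?_
  · refine Finset.measurable_fun_sum _ fun i _ => Measurable.mul_const ?_ _
    exact (measurable_from_top (f := fun k : Fin (Y i) => (k.val : ℝ))).comp (measurable_pi_apply i)
  · rw [tendsto_pi_nhds]
    exact fun x => (summable_digits hY x).hasSum.tendsto_sum_nat

lemma radixSum_mem_Icc {Y : ℕ → ℕ} (hY : ∀ n, 2 ≤ Y n) (x : ∀ n, Fin (Y n)) :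
    radixSum Y x ∈ Icc (0 : ℝ) 1 := by
  simpa [gridIcc, wordIdx, gridIdx, gridCard] using radixSum_mem_gridIcc hY 0 x

/-! ### Masses of balls -/

lemma mem_nearWords_comm {Y : ℕ → ℕ} {n : ℕ} {v w : ∀ i : Fin n, Fin (Y i)} :
    v ∈ nearWords Y w ↔ w ∈ nearWords Y v := by
  simp only [nearWords, Finset.mem_filter, Finset.mem_univ, true_and]
  exact and_comm

lemma card_nearWords_le (Y : ℕ → ℕ) {n : ℕ} (w : ∀ i : Fin n, Fin (Y i)) :
    (nearWords Y w).card ≤ 5 := by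
  have h : (nearWords Y w).card ≤ (Finset.Icc (wordIdx Y w - 2) (wordIdx Y w + 2)).card := by
    refine Finset.card_le_card_of_injOn (wordIdx Y) (fun v hv => ?_)
      (wordIdx_injective Y n).injOn
    simp only [nearWords, Finset.coe_filter, Finset.mem_univ, true_and, mem_ofPred_eq] at hv
    simp only [Finset.coe_Icc, mem_Icc]
    omega
  rw [Nat.card_Icc] at h
  omega

lemma subset_preimage_closedBall {Y : ℕ → ℕ} (hY : ∀ n, 2 ≤ Y n) {n : ℕ}
    {w : ∀ i : Fin n, Fin (Y i)} {x r : ℝ} (hx : x ∈ gridIcc Y n (wordIdx Y w))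
    (hr : (gridCard Y n : ℝ)⁻¹ ≤ r) :
    {y : ∀ i, Fin (Y i) | ∀ i : Fin n, y i = w i} ⊆ radixSum Y ⁻¹' closedBall x r := by
  intro y hy
  have h := radixSum_mem_gridIcc hY n y
  rw [show (fun i : Fin n => y i) = w from funext hy] at h
  rw [mem_preimage, mem_closedBall, Real.dist_eq, abs_le]
  simp only [gridIcc, mem_Icc, add_mul, one_mul] at h hx
  constructor <;> linarith [h.1, h.2, hx.1, hx.2]

lemma preimage_closedBall_subset {Y : ℕ → ℕ} (hY : ∀ n, 2 ≤ Y n) {n : ℕ}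
    {w : ∀ i : Fin n, Fin (Y i)} {x : ℝ} (hx : x ∈ gridIcc Y n (wordIdx Y w)) :
    radixSum Y ⁻¹' closedBall x (gridCard Y n : ℝ)⁻¹ ⊆
      ⋃ v ∈ nearWords Y w, {y : ∀ i, Fin (Y i) | ∀ i : Fin n, y i = v i} := by
  intro y hy
  have hM : (0 : ℝ) < (gridCard Y n : ℝ)⁻¹ := by
    have := gridCard_pos hY n
    positivity
  have h := radixSum_mem_gridIcc hY n y
  rw [mem_preimage, mem_closedBall, Real.dist_eq, abs_le] at hy
  refine mem_biUnion (x := fun i : Fin n => y i) ?_ fun _ => rfl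
  simp only [gridIcc, mem_Icc] at h hx
  simp only [nearWords, Finset.coe_filter, Finset.mem_univ, true_and, mem_ofPred_eq]
  constructor
  · have : ((wordIdx Y fun i : Fin n => y i) : ℝ) ≤ wordIdx Y w + 2 := by
      refine le_of_mul_le_mul_right ?_ hM
      linarith [h.1, hx.2, hy.2]
    exact_mod_cast this
  · have : (wordIdx Y w : ℝ) ≤ (wordIdx Y fun i : Fin n => y i) + 2 := by
      refine le_of_mul_le_mul_right ?_ hM
      linarith [h.2, hx.1, hy.1]
    exact_mod_cast this

lemma sum_rpow_le_card_rpow_mul {ι : Type*} (s : Finset ι) (f : ι → ℝ≥0∞) {q : ℝ} (hq : 0 < q) :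
    (∑ i ∈ s, f i) ^ q ≤ (s.card : ℝ≥0∞) ^ q * ∑ i ∈ s, f i ^ q := by
  rcases s.eq_empty_or_nonempty with rfl | hs
  · simp [hq]
  obtain ⟨j, hj, hmax⟩ := s.exists_max_image f hs
  calc (∑ i ∈ s, f i) ^ q ≤ ((s.card : ℝ≥0∞) * f j) ^ q := by
        refine ENNReal.rpow_le_rpow ?_ hq.le
        rw [← nsmul_eq_mul]
        exact Finset.sum_le_card_nsmul _ _ _ hmax
    _ = (s.card : ℝ≥0∞) ^ q * f j ^ q := ENNReal.mul_rpow_of_nonneg _ _ hq.le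
    _ ≤ _ := by
        gcongr
        exact Finset.single_le_sum (f := fun i => f i ^ q) (fun _ _ => zero_le) hj

lemma ennreal_rpow_le_rpow_of_nonpos {x y : ℝ≥0∞} {q : ℝ} (h : x ≤ y) (hq : q ≤ 0) :
    y ^ q ≤ x ^ q := by
  rw [← neg_neg q, ENNReal.rpow_neg y, ENNReal.rpow_neg x]
  exact ENNReal.inv_le_inv.2 (ENNReal.rpow_le_rpow h (neg_nonneg.2 hq))

lemma measure_closedBall_rpow_le {Y : ℕ → ℕ} (hY : ∀ n, 2 ≤ Y n)
    (μ : Measure (∀ n, Fin (Y n))) (q : ℝ) {n : ℕ} {w : ∀ i : Fin n, Fin (Y i)} {x : ℝ}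
    (hx : x ∈ gridIcc Y n (wordIdx Y w)) :
    μ.map (radixSum Y) (closedBall x (gridCard Y n : ℝ)⁻¹) ^ q ≤
      5 ^ |q| * ∑ v ∈ nearWords Y w, μ {y | ∀ i : Fin n, y i = v i} ^ q := by
  rw [Measure.map_apply (measurable_radixSum hY) measurableSet_closedBall]
  rcases le_or_gt q 0 with hq | hq
  · calc _ ≤ μ {y | ∀ i : Fin n, y i = w i} ^ q :=
          ennreal_rpow_le_rpow_of_nonpos
            (measure_mono (subset_preimage_closedBall hY hx le_rfl)) hq
      _ ≤ ∑ v ∈ nearWords Y w, μ {y | ∀ i : Fin n, y i = v i} ^ q :=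
          Finset.single_le_sum (f := fun v : ∀ i : Fin n, Fin (Y i) => μ {y | ∀ i : Fin n, y i = v i} ^ q)
            (fun _ _ => zero_le) (by simp [nearWords])
      _ ≤ _ := le_mul_of_one_le_left zero_le
          (by simpa using ENNReal.rpow_le_rpow (x := 1) (y := 5) (by norm_num) (abs_nonneg q))
  · rw [abs_of_pos hq]
    calc _ ≤ (∑ v ∈ nearWords Y w, μ {y | ∀ i : Fin n, y i = v i}) ^ q := by
          refine ENNReal.rpow_le_rpow ?_ hq.le
          exact (measure_mono (preimage_closedBall_subset hY hx)).trans
            (measure_biUnion_finset_le _ _)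
      _ ≤ _ := sum_rpow_le_card_rpow_mul _ _ hq
      _ ≤ _ := by
          gcongr
          exact_mod_cast card_nearWords_le Y w

lemma Hdel_map_radixSum_le {Y : ℕ → ℕ} (hY : ∀ n, 2 ≤ Y n)
    (μ : Measure (∀ n, Fin (Y n))) (q t : ℝ) {δ : ℝ} {n : ℕ}
    (hδ : (gridCard Y n : ℝ)⁻¹ ≤ δ) {F : Set ℝ} (hF : F ⊆ Icc (0 : ℝ) 1) :
    Hdel (μ.map (radixSum Y)) q t δ F ≤
      5 ^ |q| * 5 * (∑ w : ∀ i : Fin n, Fin (Y i), μ {y | ∀ i : Fin n, y i = w i} ^ q) *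
        ENNReal.ofReal (2 * (gridCard Y n : ℝ)⁻¹) ^ t := by
  have hM : (0 : ℝ) < (gridCard Y n : ℝ)⁻¹ := by
    have := gridCard_pos hY n
    positivity
  let ι : Type := {w : ∀ i : Fin n, Fin (Y i) // (F ∩ gridIcc Y n (wordIdx Y w)).Nonempty}
  let c : ι → ℝ := fun w => w.2.some
  have hcF : ∀ w, c w ∈ F := fun w => w.2.some_mem.1
  have hcI : ∀ w : ι, c w ∈ gridIcc Y n (wordIdx Y w.1) := fun w => w.2.some_mem.2
  have hcov : F ⊆ ⋃ w : ι, closedBall (c w) (gridCard Y n : ℝ)⁻¹ := by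
    intro x hx
    obtain ⟨w, hw⟩ := exists_mem_gridIcc hY n (hF hx)
    refine mem_iUnion.2 ⟨⟨w, x, hx, hw⟩, ?_⟩
    have h := hcI ⟨w, x, hx, hw⟩
    rw [mem_closedBall, Real.dist_eq, abs_le]
    simp only [gridIcc, mem_Icc, add_mul, one_mul] at h hw
    constructor <;> linarith [h.1, h.2, hw.1, hw.2]
  calc Hdel (μ.map (radixSum Y)) q t δ F
      ≤ olsenSum (μ.map (radixSum Y)) q t c fun _ => (gridCard Y n : ℝ)⁻¹ :=
        iInf_le_of_le ι <| iInf_le_of_le inferInstance <| iInf_le_of_le c <|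
          iInf_le_of_le (fun _ => (gridCard Y n : ℝ)⁻¹) <| iInf_le_of_le hcF <|
          iInf_le_of_le (fun _ => ⟨hM, hδ⟩) <| iInf_le _ hcov
    _ ≤ ∑' w : ι, (5 ^ |q| * ∑ v ∈ nearWords Y w.1, μ {y | ∀ i : Fin n, y i = v i} ^ q) *
          ENNReal.ofReal (2 * (gridCard Y n : ℝ)⁻¹) ^ t :=
        ENNReal.tsum_le_tsum fun w => mul_le_mul_left
          (measure_closedBall_rpow_le hY μ q (hcI w)) _
    _ ≤ ∑' w : ∀ i : Fin n, Fin (Y i),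
          (5 ^ |q| * ∑ v ∈ nearWords Y w, μ {y | ∀ i : Fin n, y i = v i} ^ q) *
          ENNReal.ofReal (2 * (gridCard Y n : ℝ)⁻¹) ^ t :=
        ENNReal.tsum_comp_le_tsum_of_injective Subtype.val_injective _
    _ = 5 ^ |q| * (∑ w : ∀ i : Fin n, Fin (Y i), ∑ v ∈ nearWords Y w,
          μ {y | ∀ i : Fin n, y i = v i} ^ q) *
          ENNReal.ofReal (2 * (gridCard Y n : ℝ)⁻¹) ^ t := by
        rw [tsum_fintype, ← Finset.sum_mul, ← Finset.mul_sum]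
    _ = 5 ^ |q| * (∑ v : ∀ i : Fin n, Fin (Y i), (nearWords Y v).card *
          μ {y | ∀ i : Fin n, y i = v i} ^ q) *
          ENNReal.ofReal (2 * (gridCard Y n : ℝ)⁻¹) ^ t := by
        congr 2
        rw [Finset.sum_comm' (t' := Finset.univ) (s' := fun v => nearWords Y v)
          (fun w v => by simp [mem_nearWords_comm (v := v)])]
        simp
    _ ≤ 5 ^ |q| * (∑ v : ∀ i : Fin n, Fin (Y i), 5 *
          μ {y | ∀ i : Fin n, y i = v i} ^ q) *
          ENNReal.ofReal (2 * (gridCard Y n : ℝ)⁻¹) ^ t := by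
        gcongr with v
        exact_mod_cast card_nearWords_le Y v
    _ = _ := by rw [← Finset.mul_sum, ← mul_assoc (5 ^ |q|)]

lemma closedBall_lower_bound {Y : ℕ → ℕ} (hY : ∀ n, 2 ≤ Y n) {μ : Measure (∀ n, Fin (Y n))}
    {p : ℝ} (hp : 0 < p)
    (hμ : ∀ (n : ℕ) (w : ∀ i : Fin n, Fin (Y i)),
      ENNReal.ofReal (p ^ n) ≤ μ {y | ∀ i : Fin n, y i = w i})
    {s : ℝ} (hs : 0 ≤ s) (hps : p = (1 / 2 : ℝ) ^ s) {x r : ℝ} (hx : x ∈ Icc (0 : ℝ) 1)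
    (hr : 0 < r) (hr1 : r ≤ 1) :
    ENNReal.ofReal (p * r ^ s) ≤ μ.map (radixSum Y) (closedBall x r) := by
  obtain ⟨n, hn, hn'⟩ := exists_nat_pow_near_of_lt_one hr hr1
    (by norm_num : (0 : ℝ) < 1 / 2) (by norm_num)
  obtain ⟨w, hw⟩ := exists_mem_gridIcc hY (n + 1) hx
  have hM : (gridCard Y (n + 1) : ℝ)⁻¹ ≤ r := by
    refine le_trans ?_ hn.le
    rw [one_div, inv_pow]
    exact inv_anti₀ (by positivity) (by exact_mod_cast two_pow_le_gridCard hY (n + 1))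
  rw [Measure.map_apply (measurable_radixSum hY) measurableSet_closedBall]
  refine le_trans ?_ (measure_mono (subset_preimage_closedBall hY hw hM))
  refine le_trans (ENNReal.ofReal_le_ofReal ?_) (hμ (n + 1) w)
  rw [pow_succ']
  gcongr
  calc r ^ s ≤ ((1 / 2 : ℝ) ^ n) ^ s := Real.rpow_le_rpow hr.le hn' hs
    _ = p ^ n := by
      rw [hps, ← Real.rpow_natCast, ← Real.rpow_natCast, ← Real.rpow_mul (by norm_num),
        ← Real.rpow_mul (by norm_num), mul_comm]

lemma msupport_map_radixSum {Y : ℕ → ℕ} (hY : ∀ n, 2 ≤ Y n) {μ : Measure (∀ n, Fin (Y n))}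
    (hpos : ∀ (n : ℕ) (w : ∀ i : Fin n, Fin (Y i)), 0 < μ {y | ∀ i : Fin n, y i = w i}) :
    msupport (μ.map (radixSum Y)) = Icc (0 : ℝ) 1 := by
  ext x
  constructor
  · intro hx
    by_contra hx'
    obtain ⟨r, hr, hball⟩ := Metric.isOpen_iff.1 (isClosed_Icc (a := (0 : ℝ)) (b := 1)).isOpen_compl
      x hx'
    have h0 := hx r hr
    rw [Measure.map_apply (measurable_radixSum hY) measurableSet_ball] at h0
    refine h0.ne' ?_
    convert measure_empty (μ := μ)
    exact eq_empty_of_forall_notMem fun y hy => hball hy (radixSum_mem_Icc hY y)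
  · intro hx r hr
    obtain ⟨n, hn⟩ := ((tendsto_gridCard hY).inv_tendsto_atTop.eventually_lt_const
      (half_pos hr)).exists
    obtain ⟨w, hw⟩ := exists_mem_gridIcc hY n hx
    calc 0 < μ {y | ∀ i : Fin n, y i = w i} := hpos n w
      _ ≤ μ (radixSum Y ⁻¹' closedBall x (r / 2)) :=
        measure_mono (subset_preimage_closedBall hY hw hn.le)
      _ ≤ μ (radixSum Y ⁻¹' ball x r) :=
        measure_mono (preimage_mono (closedBall_subset_ball (half_lt_self hr)))
      _ = _ := (Measure.map_apply (measurable_radixSum hY) measurableSet_ball).symm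

lemma Hmeas_Icc_pos {m : Measure ℝ} [IsProbabilityMeasure m] {p s : ℝ} (hp : 0 < p)
    (hs : 0 ≤ s) (hp1 : p ≤ 1)
    (hball : ∀ x ∈ Icc (0 : ℝ) 1, ∀ r, 0 < r → r ≤ 1 →
      ENNReal.ofReal (p * r ^ s) ≤ m (closedBall x r))
    {q t : ℝ} (ht : t ≤ -(s * |q|)) : 0 < Hmeas m q t (Icc (0 : ℝ) 1) := by
  have hK : 0 < p ^ |q| * 2 ^ (-(s * |q|)) := by positivity
  refine lt_of_lt_of_le (ENNReal.ofReal_pos.2 hK) ?_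
  refine le_iSup₂_of_le (Icc 0 1) subset_rfl (le_iSup₂_of_le (1 / 2) (by norm_num) ?_)
  simp only [Hdel, le_iInf_iff]
  intro ι _ c r hc hr hcov
  obtain ⟨i, -⟩ := mem_iUnion.1 (hcov (left_mem_Icc.2 zero_le_one))
  obtain ⟨hr0, hr1⟩ := hr i
  refine le_trans ?_ (ENNReal.le_tsum i)
  have hmass : ENNReal.ofReal ((p * r i ^ s) ^ |q|) ≤ m (closedBall (c i) (r i)) ^ q := by
    have h0 : 0 ≤ p * r i ^ s := by positivity
    rcases le_total q 0 with hq | hq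
    · refine le_trans (b := 1) ?_ ?_
      · rw [ENNReal.ofReal_le_one]
        exact Real.rpow_le_one h0 (mul_le_one₀ hp1 (by positivity)
          (Real.rpow_le_one hr0.le (by linarith) hs)) (abs_nonneg q)
      · simpa using ennreal_rpow_le_rpow_of_nonpos (prob_le_one (μ := m)) hq
    · rw [abs_of_nonneg hq, ← ENNReal.ofReal_rpow_of_nonneg h0 hq]
      exact ENNReal.rpow_le_rpow (hball _ (hc i) _ hr0 (by linarith)) hq
  rw [ENNReal.ofReal_rpow_of_pos (by positivity)]
  refine le_trans ?_ (mul_le_mul_left hmass _)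
  rw [← ENNReal.ofReal_mul (by positivity)]
  refine ENNReal.ofReal_le_ofReal ?_
  calc p ^ |q| * 2 ^ (-(s * |q|)) = (p * r i ^ s) ^ |q| * (2 * r i) ^ (-(s * |q|)) := by
        rw [Real.mul_rpow hp.le (by positivity), Real.mul_rpow zero_le_two hr0.le,
          ← Real.rpow_mul hr0.le, Real.rpow_neg hr0.le (s * |q|)]
        have : r i ^ (s * |q|) ≠ 0 := by positivity
        field_simp
    _ ≤ _ := by
        gcongr ?_ * ?_
        exact Real.rpow_le_rpow_of_exponent_ge (by positivity) (by linarith) ht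

/-! ### The mixed symbolic space -/

lemma Ncount_succ (T : ℕ → ℕ) (n : ℕ) :
    Ncount T (n + 1) = Ncount T n + if isA T (n + 1) then 1 else 0 := by
  rw [Ncount, Ncount, ← Finset.insert_Icc_right_eq_Icc_add_one (by omega), Finset.filter_insert]
  split_ifs with h
  · rw [Finset.card_insert_of_notMem (by simp)]
  · rfl

lemma Ncount_le (T : ℕ → ℕ) (n : ℕ) : Ncount T n ≤ n := by
  refine (Finset.card_filter_le _ _).trans ?_
  simp

lemma gridCard_Yc (c₁ c₂ : ℕ) (T : ℕ → ℕ) (n : ℕ) :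
    gridCard (Yc c₁ c₂ T) n = c₁ ^ Ncount T n * c₂ ^ (n - Ncount T n) := by
  induction n with
  | zero => simp [gridCard, Ncount]
  | succ n ih =>
    have := Ncount_le T n
    rw [gridCard_succ, ih, Ncount_succ, Yc]
    split_ifs
    · rw [Nat.add_sub_add_right]; ring
    · rw [add_zero, Nat.succ_sub this, pow_succ]; ring

lemma gammaMap_eq_radixSum (c₁ c₂ : ℕ) (T : ℕ → ℕ) :
    gammaMap c₁ c₂ T = radixSum (Yc c₁ c₂ T) := by
  funext x
  simp only [gammaMap, radixSum, Dw, gridCard_Yc]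
  push_cast
  rfl

lemma tauN_eq (c₁ c₂ : ℕ) (T : ℕ → ℕ) (a b : ℕ → ℝ) (q : ℝ) (n : ℕ) :
    tauN c₁ c₂ T a b q n = Real.log (∑ z : Word c₁ c₂ T n, cylWeight c₁ c₂ T a b n z ^ q) /
      Real.log (gridCard (Yc c₁ c₂ T) n) := by
  rw [tauN, gridCard_Yc]
  push_cast
  rfl

lemma two_le_Yc {c₁ c₂ : ℕ} (hc₁ : 2 ≤ c₁) (hc₂ : 2 ≤ c₂) (T : ℕ → ℕ) (n : ℕ) :
    2 ≤ Yc c₁ c₂ T n := by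
  unfold Yc
  split_ifs <;> assumption

lemma exists_pos_le_weights {c : ℕ} {f : ℕ → ℝ} (hf : ∀ i < c, 0 < f i) :
    ∃ p : ℝ, 0 < p ∧ ∀ i < c, p ≤ f i := by
  rcases Nat.eq_zero_or_pos c with rfl | hc
  · exact ⟨1, one_pos, by simp⟩
  obtain ⟨j, hj, hmin⟩ := (Finset.range c).exists_min_image f ⟨0, by simpa⟩
  exact ⟨f j, hf j (Finset.mem_range.1 hj), fun i hi => hmin i (Finset.mem_range.2 hi)⟩

/-- If every letter has weight at least `p`, every word of length `n` has weight at least `p ^ n`. -/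
lemma pow_le_cylWeight {c₁ c₂ : ℕ} {T : ℕ → ℕ} {a b : ℕ → ℝ} {p : ℝ} (hp : 0 ≤ p)
    (ha : ∀ i < c₁, p ≤ a i) (hb : ∀ i < c₂, p ≤ b i) (n : ℕ) (w : Word c₁ c₂ T n) :
    p ^ n ≤ cylWeight c₁ c₂ T a b n w := by
  have h := Finset.prod_le_prod (s := Finset.univ) (f := fun _ : Fin n => p)
    (g := fun i : Fin n => if isA T (i.val + 1) then a (w i).val else b (w i).val)
    (fun _ _ => hp) fun i _ => by
      have hi := (w i).2
      unfold Yc at hi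
      split_ifs at hi ⊢ with h
      · exact ha _ hi
      · exact hb _ hi
  simpa [cylWeight] using h

lemma sum_cylWeight_rpow_le {c₁ c₂ : ℕ} {T : ℕ → ℕ} {a b : ℕ → ℝ}
    (ha : ∀ i < c₁, 0 < a i) (hb : ∀ i < c₂, 0 < b i) (q : ℝ) :
    ∃ B : ℝ, 1 ≤ B ∧ ∀ n, ∑ z : Word c₁ c₂ T n, cylWeight c₁ c₂ T a b n z ^ q ≤ B ^ n := by
  refine ⟨max 1 (max (∑ i ∈ Finset.range c₁, a i ^ q) (∑ i ∈ Finset.range c₂, b i ^ q)),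
    le_max_left _ _, fun n => ?_⟩
  have hnn : ∀ (j : ℕ) (x : Fin (Yc c₁ c₂ T j)),
      0 ≤ if isA T (j + 1) then a x.val else b x.val := by
    intro j x
    have hx := x.2
    unfold Yc at hx
    split_ifs at hx ⊢
    · exact (ha _ hx).le
    · exact (hb _ hx).le
  have hsum : ∑ z : Word c₁ c₂ T n, cylWeight c₁ c₂ T a b n z ^ q =
      ∏ i : Fin n, ∑ x : Fin (Yc c₁ c₂ T i),
        (if isA T (i.val + 1) then a x.val else b x.val) ^ q := by
    rw [Finset.prod_univ_sum, Fintype.piFinset_univ]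
    refine Finset.sum_congr rfl fun z _ => ?_
    rw [cylWeight, ← Real.finsetProd_rpow _ _ fun (i : Fin n) _ => hnn i (z i)]
  rw [hsum]
  rw [← Fin.prod_const n]
  refine Finset.prod_le_prod (fun i _ => Finset.sum_nonneg fun x _ =>
    Real.rpow_nonneg (hnn i x) q) fun i _ => ?_
  rw [Fin.sum_univ_eq_sum_range
    (fun x => (if isA T (i.val + 1) then a x else b x) ^ q) (Yc c₁ c₂ T i)]
  unfold Yc
  split_ifs <;> simp

lemma isBoundedUnder_tauN {c₁ c₂ : ℕ} (hc₁ : 2 ≤ c₁) (hc₂ : 2 ≤ c₂) {T : ℕ → ℕ} {a b : ℕ → ℝ}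
    (ha : ∀ i < c₁, 0 < a i) (hb : ∀ i < c₂, 0 < b i) (q : ℝ)
    (hpos : ∀ n, 0 < ∑ z : Word c₁ c₂ T n, cylWeight c₁ c₂ T a b n z ^ q) :
    IsBoundedUnder (· ≤ ·) atTop (tauN c₁ c₂ T a b q) := by
  obtain ⟨B, hB, hsum⟩ := sum_cylWeight_rpow_le (T := T) ha hb q
  refine isBoundedUnder_of_eventually_le (a := Real.log B / Real.log 2) ?_
  filter_upwards [eventually_ge_atTop 1] with n hn
  have hn' : (0 : ℝ) < n := by exact_mod_cast hn
  have hlog2 : 0 < Real.log 2 := Real.log_pos one_lt_two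
  have hB0 : 0 ≤ Real.log B := Real.log_nonneg hB
  have hden : n * Real.log 2 ≤ Real.log (gridCard (Yc c₁ c₂ T) n) := by
    rw [← Real.log_pow]
    exact Real.log_le_log (by positivity)
      (by exact_mod_cast two_pow_le_gridCard (two_le_Yc hc₁ hc₂ T) n)
  have hnum := Real.log_le_log (hpos n) (hsum n)
  rw [Real.log_pow] at hnum
  rw [tauN_eq]
  calc _ ≤ n * Real.log B / (n * Real.log 2) :=
        div_le_div₀ (by positivity) hnum (by positivity) hden
    _ = _ := mul_div_mul_left _ _ hn'.ne'

lemma Hmeas_map_gammaMap_eq_zero {c₁ c₂ : ℕ} (hc₁ : 2 ≤ c₁) (hc₂ : 2 ≤ c₂) {T : ℕ → ℕ}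
    {a b : ℕ → ℝ} (ha : ∀ i < c₁, 0 < a i) (hb : ∀ i < c₂, 0 < b i)
    {μ : Measure (Omg c₁ c₂ T)}
    (hμ : ∀ (n : ℕ) (w : Word c₁ c₂ T n),
      μ (cyl c₁ c₂ T n w) = ENNReal.ofReal (cylWeight c₁ c₂ T a b n w))
    (hW : ∀ (n : ℕ) (w : Word c₁ c₂ T n), 0 < cylWeight c₁ c₂ T a b n w)
    (q : ℝ) {ε : ℝ} (hε : 0 < ε) :
    Hmeas (μ.map (gammaMap c₁ c₂ T)) q
      (Filter.liminf (tauN c₁ c₂ T a b q) atTop + ε) (Icc (0 : ℝ) 1) = 0 := by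
  set L := Filter.liminf (tauN c₁ c₂ T a b q) atTop with hL
  set M : ℕ → ℝ := fun n => gridCard (Yc c₁ c₂ T) n with hMdef
  have hY := two_le_Yc hc₁ hc₂ T
  have hpos : ∀ n, 0 < ∑ z : Word c₁ c₂ T n, cylWeight c₁ c₂ T a b n z ^ q := fun n => by
    obtain ⟨w, -⟩ := exists_wordIdx_eq (Yc c₁ c₂ T) (gridCard_pos hY n)
    exact Finset.sum_pos (fun z _ => Real.rpow_pos_of_pos (hW n z) q) ⟨w, Finset.mem_univ w⟩
  have hfreq : ∃ᶠ n in atTop, tauN c₁ c₂ T a b q n < L + ε / 2 :=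
    frequently_lt_of_liminf_lt
      (isBoundedUnder_tauN hc₁ hc₂ ha hb q hpos).isCoboundedUnder_ge (by linarith)
  have hlim : Tendsto (fun n => ENNReal.ofReal
      (5 ^ |q| * 5 * 2 ^ (L + ε) * M n ^ (-(ε / 2)))) atTop (𝓝 0) := by
    rw [← ENNReal.ofReal_zero]
    refine ENNReal.tendsto_ofReal ?_
    simpa using ((tendsto_rpow_neg_atTop (half_pos hε)).comp (tendsto_gridCard hY)).const_mul
      ((5 : ℝ) ^ |q| * 5 * 2 ^ (L + ε))
  rw [gammaMap_eq_radixSum]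
  simp only [Hmeas, Hpre, ENNReal.iSup_eq_zero]
  intro F hF δ hδ
  refine nonpos_iff_eq_zero.1 (le_of_forall_gt fun η hη => ?_)
  have hδn : ∀ᶠ n in atTop, (M n)⁻¹ ≤ δ :=
    (tendsto_gridCard hY).inv_tendsto_atTop.eventually_le_const hδ
  obtain ⟨n, hτ, hη', hδ', hn⟩ := (hfreq.and_eventually ((hlim.eventually_lt_const hη).and
    (hδn.and (eventually_ge_atTop 1)))).exists
  refine lt_of_le_of_lt ((Hdel_map_radixSum_le hY μ q (L + ε) hδ' hF).trans ?_) hη'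
  have hM1 : 1 < M n := by
    have : (2 : ℝ) ^ n ≤ M n := by
      simp only [hMdef]
      exact_mod_cast two_pow_le_gridCard hY n
    exact lt_of_lt_of_le (one_lt_pow₀ one_lt_two (by omega)) this
  have hM0 : 0 < M n := by linarith
  have hsum : ∑ w : Word c₁ c₂ T n, μ (cyl c₁ c₂ T n w) ^ q =
      ENNReal.ofReal (M n ^ tauN c₁ c₂ T a b q n) := by
    rw [tauN_eq, Real.rpow_def_of_pos hM0, mul_div_cancel₀ _ (Real.log_pos hM1).ne',
      Real.exp_log (hpos n), ENNReal.ofReal_sum_of_nonneg fun z _ => Real.rpow_nonneg (hW n z).le q]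
    exact Finset.sum_congr rfl fun z _ => by rw [hμ, ENNReal.ofReal_rpow_of_pos (hW n z)]
  have h5 : (5 : ℝ≥0∞) ^ |q| * 5 = ENNReal.ofReal (5 ^ |q| * 5) := by
    rw [ENNReal.ofReal_mul (by positivity), ← ENNReal.ofReal_rpow_of_pos (by norm_num)]
    simp
  calc _ = ENNReal.ofReal (5 ^ |q| * 5 * M n ^ tauN c₁ c₂ T a b q n *
        (2 * (M n)⁻¹) ^ (L + ε)) := by
        rw [ENNReal.ofReal_mul (p := 5 ^ |q| * 5 * M n ^ tauN c₁ c₂ T a b q n) (by positivity),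
          ENNReal.ofReal_mul (p := 5 ^ |q| * 5) (by positivity), ← h5, ← hsum,
          ← ENNReal.ofReal_rpow_of_pos (p := L + ε) (by positivity)]
        rfl
    _ ≤ _ := by
        refine ENNReal.ofReal_le_ofReal ?_
        rw [Real.mul_rpow zero_le_two (by positivity), Real.inv_rpow hM0.le,
          ← Real.rpow_neg hM0.le]
        calc _ = 5 ^ |q| * 5 * 2 ^ (L + ε) * M n ^ (tauN c₁ c₂ T a b q n + -(L + ε)) := by
              rw [Real.rpow_add hM0]; ring
          _ ≤ _ := by
              gcongr
              · exact hM1.le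
              · linarith

/-- `𝓗^{q, τ̲_μ(q)+ε}_ν([0,1]) ≤ 1`, hence `b_ν(q) ≤ τ̲_μ(q)`. -/
theorem stmt7 (c₁ c₂ : ℕ) (hc₁ : 2 ≤ c₁) (hc₂ : 2 ≤ c₂)
    (T : ℕ → ℕ) (hT1 : T 1 = 1) (hTmono : ∀ k, 1 ≤ k → T k < T (k + 1))
    (hTrat : Tendsto (fun k => (T (k + 1) : ℝ) / (T k : ℝ)) atTop atTop)
    (a b : ℕ → ℝ) (ha : ∀ i, i < c₁ → 0 < a i ∧ a i < 1)
    (hb : ∀ j, j < c₂ → 0 < b j ∧ b j < 1)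
    (hsa : ∑ i ∈ Finset.range c₁, a i = 1) (hsb : ∑ j ∈ Finset.range c₂, b j = 1)
    (μ : Measure (Omg c₁ c₂ T)) [IsProbabilityMeasure μ]
    (hμ : ∀ (n : ℕ) (w : Word c₁ c₂ T n),
      μ (cyl c₁ c₂ T n w) = ENNReal.ofReal (cylWeight c₁ c₂ T a b n w))
    (q ε : ℝ) (hε : 0 < ε) :
    Hmeas (μ.map (gammaMap c₁ c₂ T)) q
        (Filter.liminf (tauN c₁ c₂ T a b q) atTop + ε) (Set.Icc (0 : ℝ) 1) ≤ 1 ∧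
    bFun (μ.map (gammaMap c₁ c₂ T)) q ≤ Filter.liminf (tauN c₁ c₂ T a b q) atTop := by
  have ha0 : ∀ i < c₁, 0 < a i := fun i hi => (ha i hi).1
  have hb0 : ∀ i < c₂, 0 < b i := fun i hi => (hb i hi).1
  have hY := two_le_Yc hc₁ hc₂ T
  obtain ⟨pa, hpa, hpa'⟩ := exists_pos_le_weights ha0
  obtain ⟨pb, hpb, hpb'⟩ := exists_pos_le_weights hb0
  set p := min pa pb with hpdef
  have hp : 0 < p := lt_min hpa hpb
  have hp1 : p ≤ 1 := (min_le_left _ _).trans ((hpa' 0 (by omega)).trans (ha 0 (by omega)).2.le)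
  have hWp : ∀ (n : ℕ) (w : Word c₁ c₂ T n), p ^ n ≤ cylWeight c₁ c₂ T a b n w :=
    pow_le_cylWeight hp.le (fun i hi => (min_le_left _ _).trans (hpa' i hi))
      (fun i hi => (min_le_right _ _).trans (hpb' i hi))
  have hW : ∀ (n : ℕ) (w : Word c₁ c₂ T n), 0 < cylWeight c₁ c₂ T a b n w :=
    fun n w => (pow_pos hp n).trans_le (hWp n w)
  have hzero : ∀ η : ℝ, 0 < η → Hmeas (μ.map (gammaMap c₁ c₂ T)) q
      (Filter.liminf (tauN c₁ c₂ T a b q) atTop + η) (Set.Icc (0 : ℝ) 1) = 0 :=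
    fun η hη => Hmeas_map_gammaMap_eq_zero hc₁ hc₂ ha0 hb0 hμ hW q hη
  refine ⟨by simp [hzero ε hε], ?_⟩
  have hsupp : msupport (μ.map (gammaMap c₁ c₂ T)) = Set.Icc (0 : ℝ) 1 := by
    rw [gammaMap_eq_radixSum]
    refine msupport_map_radixSum hY fun n w => ?_
    exact (ENNReal.ofReal_pos.2 (hW n w)).trans_eq (hμ n w).symm
  have hs : 0 ≤ Real.logb (1 / 2) p :=
    Real.logb_nonneg_of_base_lt_one (by norm_num) (by norm_num) hp hp1
  have hprob : IsProbabilityMeasure (μ.map (gammaMap c₁ c₂ T)) := by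
    rw [gammaMap_eq_radixSum]
    exact Measure.isProbabilityMeasure_map (measurable_radixSum hY).aemeasurable
  have hbdd : BddBelow {t | Hmeas (μ.map (gammaMap c₁ c₂ T)) q t (Set.Icc (0 : ℝ) 1) = 0} := by
    refine ⟨-(Real.logb (1 / 2) p * |q|), fun t ht => ?_⟩
    by_contra! hlt
    refine (Hmeas_Icc_pos hp hs hp1 (fun x hx r hr hr1 => ?_) hlt.le).ne' ht
    rw [gammaMap_eq_radixSum]
    refine closedBall_lower_bound hY hp (fun n w => ?_) hs
      (Real.rpow_logb (by norm_num) (by norm_num) hp).symm hx hr hr1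
    exact (ENNReal.ofReal_le_ofReal (hWp n w)).trans_eq (hμ n w).symm
  refine le_of_forall_pos_le_add fun η hη => ?_
  rw [bFun, hsupp]
  exact csInf_le hbdd (hzero η hη)

end MF
end
end
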